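/- For every integer k ≥ 2 there exists a constant c_k such that for every positive integer n there exists a 2-(n,k,1) packing with at least ⌊(n/k)·⌊(n−1)/(k−1)⌋⌋ − c_k blocks. -/

import Mathlib

/-- `R` is decomposed into `k`-blocks. -/
def Dec (k : ℕ) {X : Type} (R : X → X → Prop) : Prop :=
  ∃ B : Set (Finset X), (∀ b ∈ B, b.card = k) ∧
    (∀ b ∈ B, ∀ x ∈ b, ∀ y ∈ b, x ≠ y → R x y) ∧
    (∀ x y, R x y → ∃ b ∈ B, x ∈ b ∧ y ∈ b) ∧
    (∀ b ∈ B, ∀ b' ∈ B, ∀ x y, x ≠ y → x ∈ b → y ∈ b → x ∈ b' → y ∈ b' → b = b')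

theorem Dec.of_family {k : ℕ} {X ι : Type} {R : X → X → Prop} (f : ι → Fin k → X)
    (hinj : ∀ i, Function.Injective (f i))
    (hR : ∀ i a b, a ≠ b → R (f i a) (f i b))
    (hcov : ∀ x y, R x y → ∃ i a b, f i a = x ∧ f i b = y)
    (huniq : ∀ i i' a b a' b', a ≠ b → f i a = f i' a' → f i b = f i' b' → i = i') :
    Dec k R := by
  classical
  refine ⟨Set.range fun i => Finset.univ.image (f i), ?_, ?_, ?_, ?_⟩
  · rintro _ ⟨i, rfl⟩
    simp [Finset.card_image_of_injective _ (hinj i)]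
  · rintro _ ⟨i, rfl⟩ x hx y hy hxy
    simp only [Finset.mem_image, Finset.mem_univ, true_and] at hx hy
    obtain ⟨a, rfl⟩ := hx
    obtain ⟨b, rfl⟩ := hy
    exact hR i a b (fun h => hxy (by rw [h]))
  · intro x y h
    obtain ⟨i, a, b, rfl, rfl⟩ := hcov x y h
    exact ⟨_, ⟨i, rfl⟩, by simp, by simp⟩
  · rintro _ ⟨i, rfl⟩ _ ⟨j, rfl⟩ x y hxy hx hy hx' hy'
    simp only [Finset.mem_image, Finset.mem_univ, true_and] at hx hy hx' hy'
    obtain ⟨a, rfl⟩ := hx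
    obtain ⟨b, rfl⟩ := hy
    obtain ⟨a', ha'⟩ := hx'
    obtain ⟨b', hb'⟩ := hy'
    have := huniq i j a b a' b' (fun h => hxy (by rw [h])) ha'.symm hb'.symm
    rw [this]

theorem Dec.congr {k : ℕ} {X : Type} {R S : X → X → Prop} (h : Dec k R)
    (hRS : ∀ x y, R x y ↔ S x y) : Dec k S := by
  have : R = S := by
    funext x y
    exact propext (hRS x y)
  rwa [← this]

theorem Dec.map {k : ℕ} {X Y : Type} {R : X → X → Prop} (h : Dec k R) (f : X → Y)
    (hf : Function.Injective f) :
    Dec k (fun y y' => ∃ x x', R x x' ∧ f x = y ∧ f x' = y') := by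
  classical
  obtain ⟨B, h1, h2, h3, h4⟩ := h
  refine ⟨(fun b => b.image f) '' B, ?_, ?_, ?_, ?_⟩
  · rintro _ ⟨b, hb, rfl⟩
    simp [Finset.card_image_of_injective _ hf, h1 b hb]
  · rintro _ ⟨b, hb, rfl⟩ x hx y hy hxy
    simp only [Finset.mem_image] at hx hy
    obtain ⟨a, ha, rfl⟩ := hx
    obtain ⟨c, hc, rfl⟩ := hy
    exact ⟨a, c, h2 b hb a ha c hc (fun h => hxy (by rw [h])), rfl, rfl⟩
  · rintro _ _ ⟨x, y, h, rfl, rfl⟩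
    obtain ⟨b, hb, hx, hy⟩ := h3 x y h
    exact ⟨_, ⟨b, hb, rfl⟩, Finset.mem_image_of_mem _ hx, Finset.mem_image_of_mem _ hy⟩
  · rintro _ ⟨b, hb, rfl⟩ _ ⟨b', hb', rfl⟩ x y hxy hx hy hx' hy'
    simp only [Finset.mem_image] at hx hy hx' hy'
    obtain ⟨a, ha, rfl⟩ := hx
    obtain ⟨c, hc, rfl⟩ := hy
    obtain ⟨a', ha', e1⟩ := hx'
    obtain ⟨c', hc', e2⟩ := hy'
    rw [h4 b hb b' hb' a c (fun h => hxy (by rw [h])) ha hc (hf e1 ▸ ha') (hf e2 ▸ hc')]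

theorem Dec.union {k : ℕ} {X ι : Type} (R : ι → X → X → Prop) (h : ∀ i, Dec k (R i))
    (hu : ∀ i j x y, R i x y → R j x y → i = j) :
    Dec k (fun x y => ∃ i, R i x y) := by
  choose B h1 h2 h3 h4 using h
  refine ⟨⋃ i, B i, ?_, ?_, ?_, ?_⟩
  · intro b hb
    obtain ⟨i, hi⟩ := Set.mem_iUnion.1 hb
    exact h1 i b hi
  · intro b hb x hx y hy hxy
    obtain ⟨i, hi⟩ := Set.mem_iUnion.1 hb
    exact ⟨i, h2 i b hi x hx y hy hxy⟩
  · rintro x y ⟨i, hi⟩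
    obtain ⟨b, hb, hx, hy⟩ := h3 i x y hi
    exact ⟨b, Set.mem_iUnion.2 ⟨i, hb⟩, hx, hy⟩
  · intro b hb b' hb' x y hxy hx hy hx' hy'
    obtain ⟨i, hi⟩ := Set.mem_iUnion.1 hb
    obtain ⟨j, hj⟩ := Set.mem_iUnion.1 hb'
    have := hu i j x y (h2 i b hi x hx y hy hxy) (h2 j b' hj x hx' y hy' hxy)
    subst this
    exact h4 i b hi b' hj x y hxy hx hy hx' hy'

theorem Dec.bot (k : ℕ) (X : Type) : Dec k (fun _ _ : X => False) :=
  ⟨∅, by simp, by simp, by simp, by simp⟩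

/-- The complete multipartite relation with parts `{a} × I`, and extra points `E` carrying the
relation `R'`. -/
def GR (A I : Type) {E : Type} (R' : E → E → Prop) : (A × I) ⊕ E → (A × I) ⊕ E → Prop
  | Sum.inl a, Sum.inl b => a.1 ≠ b.1
  | Sum.inr x, Sum.inr y => R' x y
  | _, _ => True

/-- There is a `k`-GDD of type `i ^ a e ^ 1`. -/
def DD (k a i e : ℕ) : Prop := Dec k (GR (Fin a) (Fin i) (fun _ _ : Fin e => False))

theorem Dec.equiv {k : ℕ} {X Y : Type} {R : X → X → Prop} {S : Y → Y → Prop} (h : Dec k R)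
    (f : X ≃ Y) (hS : ∀ x y, R x y ↔ S (f x) (f y)) : Dec k S := by
  refine (h.map f f.injective).congr ?_
  intro y y'
  constructor
  · rintro ⟨x, x', h, rfl, rfl⟩
    exact (hS _ _).1 h
  · intro h
    exact ⟨f.symm y, f.symm y', (hS _ _).2 (by simpa using h), by simp, by simp⟩

theorem Dec.GR_equiv {k : ℕ} {A I E A' I' E' : Type} {R : E → E → Prop} {R' : E' → E' → Prop}
    (h : Dec k (GR A I R)) (fA : A ≃ A') (fI : I ≃ I') (fE : E ≃ E')
    (hR : ∀ x y, R x y ↔ R' (fE x) (fE y)) : Dec k (GR A' I' R') := by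
  refine h.equiv (Equiv.sumCongr (Equiv.prodCongr fA fI) fE) ?_
  rintro (x | x) (y | y) <;> simp [GR, hR]

theorem DD.toTypes {k a i e : ℕ} (h : DD k a i e) (A I E : Type) [Fintype A] [Fintype I]
    [Fintype E] (hA : Fintype.card A = a) (hI : Fintype.card I = i) (hE : Fintype.card E = e) :
    Dec k (GR A I (fun _ _ : E => False)) := by
  subst hA hI hE
  exact Dec.GR_equiv h (Fintype.equivFin A).symm (Fintype.equivFin I).symm
    (Fintype.equivFin E).symm (by simp)

theorem DD.ofTypes {k : ℕ} {A I E : Type} [Fintype A] [Fintype I]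
    [Fintype E] (h : Dec k (GR A I (fun _ _ : E => False))) {a i e : ℕ}
    (hA : Fintype.card A = a) (hI : Fintype.card I = i) (hE : Fintype.card E = e) :
    DD k a i e := by
  subst hA hI hE
  exact Dec.GR_equiv h (Fintype.equivFin A) (Fintype.equivFin I)
    (Fintype.equivFin E) (by simp)

set_option maxHeartbeats 4000000 in
/-- The filling construction. -/
theorem Dec.fill {k : ℕ} {A U G T E : Type} {R' : T ⊕ E → T ⊕ E → Prop}
    (h1 : Dec k (GR A (U × G) (fun _ _ : T => False)))
    (h2 : Dec k (GR U G (fun _ _ : E => False)))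
    (h3 : Dec k R') : Dec k (GR (A × U) G R') := by
  let f1 : (A × (U × G)) ⊕ T → ((A × U) × G) ⊕ (T ⊕ E) :=
    Sum.elim (fun x => Sum.inl ((x.1, x.2.1), x.2.2)) (fun t => Sum.inr (Sum.inl t))
  let f2 : A → (U × G) ⊕ E → ((A × U) × G) ⊕ (T ⊕ E) := fun a =>
    Sum.elim (fun x => Sum.inl ((a, x.1), x.2)) (fun t => Sum.inr (Sum.inr t))
  let f3 : T ⊕ E → ((A × U) × G) ⊕ (T ⊕ E) := Sum.inr
  have i1 : Function.Injective f1 := by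
    rintro (⟨a, u, g⟩ | t) (⟨a', u', g'⟩ | t') h <;> simp_all [f1]
  have i2 : ∀ a, Function.Injective (f2 a) := by
    rintro a (⟨u, g⟩ | t) (⟨u', g'⟩ | t') h <;> simp_all [f2]
  have i3 : Function.Injective f3 := Sum.inr_injective
  have key := Dec.union (k := k) (ι := A ⊕ Bool)
    (fun i => match i with
      | Sum.inl a => fun y y' => ∃ x x', GR U G (fun _ _ : E => False) x x' ∧
          f2 a x = y ∧ f2 a x' = y'
      | Sum.inr true => fun y y' => ∃ x x', GR A (U × G) (fun _ _ : T => False) x x' ∧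
          f1 x = y ∧ f1 x' = y'
      | Sum.inr false => fun y y' => ∃ x x', R' x x' ∧ f3 x = y ∧ f3 x' = y') ?_ ?_
  · refine key.congr ?_
    intro x y
    constructor
    · rintro ⟨(a | _ | _), z, z', h, rfl, rfl⟩
      · rcases z with ⟨u, g⟩ | z <;> rcases z' with ⟨u', g'⟩ | z' <;> simp_all [GR, f2]
      · simp_all [GR, f3]
      · rcases z with ⟨a, u, g⟩ | z <;> rcases z' with ⟨a', u', g'⟩ | z' <;> simp_all [GR, f1]
    · rcases x with ⟨⟨a, u⟩, g⟩ | t | e <;> rcases y with ⟨⟨a', u'⟩, g'⟩ | t' | e' <;> intro h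
      · by_cases haa : a = a'
        · subst haa
          refine ⟨Sum.inl a, Sum.inl (u, g), Sum.inl (u', g'), ?_, rfl, rfl⟩
          simpa [GR] using h
        · exact ⟨Sum.inr true, Sum.inl (a, u, g), Sum.inl (a', u', g'), haa, rfl, rfl⟩
      · exact ⟨Sum.inr true, Sum.inl (a, u, g), Sum.inr t', trivial, rfl, rfl⟩
      · exact ⟨Sum.inl a, Sum.inl (u, g), Sum.inr e', trivial, rfl, rfl⟩
      · exact ⟨Sum.inr true, Sum.inr t, Sum.inl (a', u', g'), trivial, rfl, rfl⟩
      · exact ⟨Sum.inr false, _, _, h, rfl, rfl⟩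
      · exact ⟨Sum.inr false, _, _, h, rfl, rfl⟩
      · exact ⟨Sum.inl a', Sum.inr e, Sum.inl (u', g'), trivial, rfl, rfl⟩
      · exact ⟨Sum.inr false, _, _, h, rfl, rfl⟩
      · exact ⟨Sum.inr false, _, _, h, rfl, rfl⟩
  · rintro (a | _ | _)
    · exact h2.map _ (i2 a)
    · exact h3.map _ i3
    · exact h1.map _ i1
  · rintro (a | _ | _) (a' | _ | _) x y ⟨z, z', h, rfl, rfl⟩ ⟨w, w', h', e, e'⟩ <;>
    rcases z with z | z <;> rcases z' with z' | z' <;>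
    rcases w with w | w <;> rcases w' with w' | w' <;> simp_all [GR, f1, f2, f3]

set_option maxHeartbeats 4000000 in
/-- Weighted truncated transversal designs. -/
theorem Dec.wtd {k q Q : ℕ} {I E T : Type} (τ : T → ZMod Q) (hτ : Function.Injective τ)
    (hQ : ∀ d : ℕ, 0 < d → d < q → Nat.Coprime d Q)
    (h0 : Dec k (GR (Fin q) I (fun _ _ : Empty => False)))
    (h1 : Dec k (GR (Fin q) I (fun _ _ : E => False))) :
    Dec k (GR (Fin q) (ZMod Q × I) (fun _ _ : T × E => False)) := by
  have hunit : ∀ i j : Fin q, i ≠ j → IsUnit (((i : ℕ) : ZMod Q) - ((j : ℕ) : ZMod Q)) := by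
    have aux : ∀ i j : Fin q, j < i → IsUnit (((i : ℕ) : ZMod Q) - ((j : ℕ) : ZMod Q)) := by
      intro i j hij
      have hij' : (j : ℕ) < i := hij
      have h := hQ (i - j) (by omega) (by omega)
      rw [← Nat.cast_sub hij'.le]
      exact (ZMod.isUnit_iff_coprime _ _).2 h
    intro i j hij
    rcases lt_or_gt_of_ne hij with h | h
    · rw [← neg_sub]
      exact (aux j i h).neg
    · exact aux i j h
  let c : Fin q → ZMod Q := fun i => ((i : ℕ) : ZMod Q)
  let f1 : ZMod Q × T → (Fin q × I) ⊕ E → (Fin q × (ZMod Q × I)) ⊕ (T × E) := fun s =>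
    Sum.elim (fun x => Sum.inl (x.1, (s.1 + c x.1 * τ s.2, x.2))) (fun e => Sum.inr (s.2, e))
  let f2 : ZMod Q × {β : ZMod Q // β ∉ Set.range τ} → (Fin q × I) ⊕ Empty →
      (Fin q × (ZMod Q × I)) ⊕ (T × E) := fun s =>
    Sum.elim (fun x => Sum.inl (x.1, (s.1 + c x.1 * s.2, x.2))) (fun e => e.elim)
  have i1 : ∀ s, Function.Injective (f1 s) := by
    rintro s (⟨a, u⟩ | t) (⟨a', u'⟩ | t') h <;> simp_all [f1]
  have i2 : ∀ s, Function.Injective (f2 s) := by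
    rintro s (⟨a, u⟩ | t) (⟨a', u'⟩ | t') h
    · simp_all [f2]
    · exact t'.elim
    · exact t.elim
    · exact t.elim
  have hc : ∀ (i j : Fin q) (α β α' β' : ZMod Q), i ≠ j → α + c i * β = α' + c i * β' →
      α + c j * β = α' + c j * β' → α = α' ∧ β = β' := by
    intro i j α β α' β' hij h h'
    have hb : β = β' := by
      apply (hunit i j hij).mul_left_cancel
      change (c i - c j) * β = (c i - c j) * β'
      linear_combination h - h'
    subst hb
    exact ⟨by linear_combination h, rfl⟩
  have hsol : ∀ (i j : Fin q) (u v : ZMod Q), i ≠ j → ∃ α β, α + c i * β = u ∧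
      α + c j * β = v := by
    intro i j u v hij
    obtain ⟨w, hw⟩ := (hunit i j hij).exists_left_inv
    change w * (c i - c j) = 1 at hw
    refine ⟨u - c i * (w * (u - v)), w * (u - v), by ring, ?_⟩
    linear_combination (- (u - v)) * hw
  have key := Dec.union (k := k)
    (ι := (ZMod Q × T) ⊕ (ZMod Q × {β : ZMod Q // β ∉ Set.range τ}))
    (fun i => match i with
      | Sum.inl s => fun y y' => ∃ x x', GR (Fin q) I (fun _ _ : E => False) x x' ∧
          f1 s x = y ∧ f1 s x' = y'
      | Sum.inr s => fun y y' => ∃ x x', GR (Fin q) I (fun _ _ : Empty => False) x x' ∧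
          f2 s x = y ∧ f2 s x' = y') ?_ ?_
  · refine key.congr ?_
    intro x y
    constructor
    · rintro ⟨(s | s), z, z', h, rfl, rfl⟩
      · rcases z with ⟨u, g⟩ | z <;> rcases z' with ⟨u', g'⟩ | z' <;> simp_all [GR, f1]
      · rcases z with ⟨u, g⟩ | z
        · rcases z' with ⟨u', g'⟩ | z'
          · simp_all [GR, f2]
          · exact z'.elim
        · exact z.elim
    · rcases x with ⟨i, u, x⟩ | ⟨t, e⟩ <;> rcases y with ⟨i', u', x'⟩ | ⟨t', e'⟩ <;> intro h
      · obtain ⟨α, β, rfl, rfl⟩ := hsol i i' u u' h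
        by_cases hβ : β ∈ Set.range τ
        · obtain ⟨t, rfl⟩ := hβ
          exact ⟨Sum.inl (α, t), Sum.inl (i, x), Sum.inl (i', x'), h, rfl, rfl⟩
        · exact ⟨Sum.inr (α, ⟨β, hβ⟩), Sum.inl (i, x), Sum.inl (i', x'), h, rfl, rfl⟩
      · refine ⟨Sum.inl (u - c i * τ t', t'), Sum.inl (i, x), Sum.inr e', trivial, ?_, rfl⟩
        simp [f1]
      · refine ⟨Sum.inl (u' - c i' * τ t, t), Sum.inr e, Sum.inl (i', x'), trivial, rfl, ?_⟩
        simp [f1]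
      · exact h.elim
  · rintro (s | s)
    · exact h1.map _ (i1 s)
    · exact h0.map _ (i2 s)
  · rintro (⟨α, t⟩ | ⟨α, β, hβ⟩) (⟨α', t'⟩ | ⟨α', β', hβ'⟩) x y ⟨z, z', h, rfl, rfl⟩
      ⟨w, w', h', e, e'⟩
    · rcases z with ⟨i, z⟩ | z <;> rcases z' with ⟨i', z'⟩ | z' <;>
      rcases w with ⟨j, w⟩ | w <;> rcases w' with ⟨j', w'⟩ | w' <;> simp [GR, f1] at h h' e e' ⊢
      · obtain ⟨rfl, e, _⟩ := e
        obtain ⟨rfl, e', _⟩ := e'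
        obtain ⟨h1, h2⟩ := hc _ _ _ _ _ _ h e e'
        exact ⟨h1.symm, (hτ h2).symm⟩
      · obtain ⟨rfl, e, _⟩ := e
        obtain ⟨rfl, _⟩ := e'
        exact ⟨by simpa using e.symm, rfl⟩
      · obtain ⟨rfl, e1, _⟩ := e'
        obtain ⟨rfl, _⟩ := e
        exact ⟨by simpa using e1.symm, rfl⟩
    · rcases z with ⟨i, z⟩ | z <;> rcases z' with ⟨i', z'⟩ | z' <;>
      rcases w with ⟨j, w⟩ | w <;> rcases w' with ⟨j', w'⟩ | w' <;> simp [GR, f1, f2] at h h' e e' ⊢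
      · obtain ⟨rfl, e, _⟩ := e
        obtain ⟨rfl, e', _⟩ := e'
        obtain ⟨h1, h2⟩ := hc _ _ _ _ _ _ h e e'
        exact hβ' ⟨t, h2.symm⟩
      all_goals first | exact w.elim | exact w'.elim
    · rcases z with ⟨i, z⟩ | z <;> rcases z' with ⟨i', z'⟩ | z' <;>
      rcases w with ⟨j, w⟩ | w <;> rcases w' with ⟨j', w'⟩ | w' <;> simp [GR, f1, f2] at h h' e e' ⊢
      · obtain ⟨rfl, e, _⟩ := e
        obtain ⟨rfl, e', _⟩ := e'
        obtain ⟨h1, h2⟩ := hc _ _ _ _ _ _ h e e'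
        exact hβ ⟨t', h2⟩
      all_goals first | exact z.elim | exact z'.elim
    · rcases z with ⟨i, z⟩ | z <;> rcases z' with ⟨i', z'⟩ | z' <;>
      rcases w with ⟨j, w⟩ | w <;> rcases w' with ⟨j', w'⟩ | w' <;> simp [GR, f2] at h h' e e' ⊢
      · obtain ⟨rfl, e, _⟩ := e
        obtain ⟨rfl, e', _⟩ := e'
        obtain ⟨h1, h2⟩ := hc _ _ _ _ _ _ h e e'
        exact ⟨h1.symm, h2.symm⟩
      all_goals first | exact w.elim | exact w'.elim | exact z.elim | exact z'.elim

open Classical in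
theorem cyc_pair {F : Type} [Field F] [Fintype F] {m : ℕ} [NeZero m] (κ : F → ZMod m)
    (hmul : ∀ x y : F, x ≠ 0 → y ≠ 0 → κ (x * y) = κ x + κ y) (y y' : F) (hy : y ≠ y') :
    (Finset.univ.filter fun x : F => y ≠ x ∧ y' ≠ x ∧ κ (y - x) = κ (y' - x)).card ≤
      (Finset.univ.filter fun d : F => d ≠ 0 ∧ κ d = 0).card := by
  apply Finset.card_le_card_of_injOn (fun x => (y - x) / (y' - x))
  · intro x hx
    simp only [Finset.coe_filter, Finset.mem_univ, true_and, Set.mem_ofPred_eq] at hx ⊢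
    obtain ⟨h1, h2, h3⟩ := hx
    have h1' : y - x ≠ 0 := sub_ne_zero.2 h1
    have h2' : y' - x ≠ 0 := sub_ne_zero.2 h2
    refine ⟨div_ne_zero h1' h2', ?_⟩
    have h := hmul ((y - x) / (y' - x)) (y' - x) (div_ne_zero h1' h2') h2'
    rw [div_mul_cancel₀ _ h2', h3] at h
    simpa using h.symm
  · intro x hx x' hx' h
    simp only [Finset.coe_filter, Finset.mem_univ, true_and, Set.mem_ofPred_eq] at hx hx' h
    have h2 : y' - x ≠ 0 := sub_ne_zero.2 hx.2.1
    have h2' : y' - x' ≠ 0 := sub_ne_zero.2 hx'.2.1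
    rw [div_eq_div_iff h2 h2'] at h
    have h3 : (y - y') * (x - x') = 0 := by linear_combination h
    rcases mul_eq_zero.1 h3 with h4 | h4
    · exact absurd (sub_eq_zero.1 h4) hy
    · exact sub_eq_zero.1 h4

open Classical in
/-- number of `y ∈ V` with `y - x` of colour `c` -/
noncomputable def nbc {F : Type} [Field F] {m : ℕ} (κ : F → ZMod m) (V : Finset F) (x : F)
    (c : ZMod m) : ℕ := (V.filter fun y => y ≠ x ∧ κ (y - x) = c).card

open Classical in
theorem cyc_moment {F : Type} [Field F] [Fintype F] {m : ℕ} [NeZero m] (κ : F → ZMod m)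
    (hmul : ∀ x y : F, x ≠ 0 → y ≠ 0 → κ (x * y) = κ x + κ y)
    (hker : (Finset.univ.filter fun d : F => d ≠ 0 ∧ κ d = 0).card * m + 1 = Fintype.card F)
    (V : Finset F) :
    ∑ x : F, ∑ c : ZMod m, ((nbc κ V x c : ℝ) - V.card / m) ^ 2 ≤
      3 * V.card * Fintype.card F := by
  have hm : (0 : ℝ) < m := by exact_mod_cast Nat.pos_of_ne_zero (NeZero.ne m)
  set h : ℕ := (Finset.univ.filter fun d : F => d ≠ 0 ∧ κ d = 0).card with hh
  set q : ℝ := (Fintype.card F : ℝ) with hq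
  have hqh : (h : ℝ) * m + 1 = q := by rw [hq, ← hker]; push_cast; ring
  let ind : F → F → ZMod m → ℝ := fun x y c => if y ≠ x ∧ κ (y - x) = c then 1 else 0
  have hn : ∀ x c, (nbc κ V x c : ℝ) = ∑ y ∈ V, ind x y c := by
    intro x c
    simp only [nbc, ind]
    rw [Finset.card_filter]
    push_cast
    rfl
  have hind1 : ∀ x y, ∑ c : ZMod m, ind x y c = if y ≠ x then 1 else 0 := by
    intro x y
    by_cases hxy : y ≠ x
    · simp [ind, hxy]
    · simp [ind, hxy]
  have hS1 : ∑ x : F, ∑ c : ZMod m, (nbc κ V x c : ℝ) = V.card * (q - 1) := by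
    calc ∑ x : F, ∑ c : ZMod m, (nbc κ V x c : ℝ)
        = ∑ x : F, ∑ y ∈ V, if y ≠ x then (1 : ℝ) else 0 := by
          refine Finset.sum_congr rfl fun x _ => ?_
          simp_rw [hn]
          rw [Finset.sum_comm]
          exact Finset.sum_congr rfl fun y _ => hind1 x y
      _ = ∑ y ∈ V, ∑ x : F, if y ≠ x then (1 : ℝ) else 0 := Finset.sum_comm
      _ = ∑ y ∈ V, (q - 1) := by
          refine Finset.sum_congr rfl fun y _ => ?_
          have : ∀ x : F, (if y ≠ x then (1 : ℝ) else 0) = 1 - if y = x then 1 else 0 := by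
            intro x
            by_cases hx : y = x <;> simp [hx]
          simp_rw [this]
          rw [Finset.sum_sub_distrib]
          simp [hq]
      _ = V.card * (q - 1) := by rw [Finset.sum_const, nsmul_eq_mul]
  have hind2 : ∀ x y y', ∑ c : ZMod m, ind x y c * ind x y' c =
      if y ≠ x ∧ y' ≠ x ∧ κ (y - x) = κ (y' - x) then 1 else 0 := by
    intro x y y'
    by_cases h1 : y ≠ x
    · by_cases h2 : y' ≠ x
      · simp only [ind, h1, h2, not_false_eq_true, true_and, ne_eq, mul_ite, mul_one, mul_zero]
        simp
      · simp [ind, h2]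
    · simp [ind, h1]
  have hS2 : ∑ x : F, ∑ c : ZMod m, (nbc κ V x c : ℝ) ^ 2 ≤ V.card * q + V.card ^ 2 * h := by
    calc ∑ x : F, ∑ c : ZMod m, (nbc κ V x c : ℝ) ^ 2
        = ∑ x : F, ∑ y ∈ V, ∑ y' ∈ V,
          (if y ≠ x ∧ y' ≠ x ∧ κ (y - x) = κ (y' - x) then (1 : ℝ) else 0) := by
          refine Finset.sum_congr rfl fun x _ => ?_
          simp_rw [hn, sq, Finset.sum_mul_sum]
          rw [Finset.sum_comm]
          refine Finset.sum_congr rfl fun y _ => ?_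
          rw [Finset.sum_comm]
          exact Finset.sum_congr rfl fun y' _ => hind2 x y y'
      _ = ∑ y ∈ V, ∑ y' ∈ V, ∑ x : F,
          (if y ≠ x ∧ y' ≠ x ∧ κ (y - x) = κ (y' - x) then (1 : ℝ) else 0) := by
          rw [Finset.sum_comm]
          refine Finset.sum_congr rfl fun y _ => ?_
          rw [Finset.sum_comm]
      _ ≤ ∑ y ∈ V, ∑ y' ∈ V, ((if y = y' then q else 0) + h) := by
          refine Finset.sum_le_sum fun y _ => Finset.sum_le_sum fun y' _ => ?_
          rw [← Finset.sum_filter, Finset.sum_const, nsmul_eq_mul, mul_one]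
          by_cases hy : y = y'
          · rw [if_pos hy]
            have : ((Finset.univ.filter fun x : F =>
                y ≠ x ∧ y' ≠ x ∧ κ (y - x) = κ (y' - x)).card : ℝ) ≤ q := by
              rw [hq]
              exact_mod_cast Finset.card_le_univ _
            have h0 : (0 : ℝ) ≤ h := Nat.cast_nonneg _
            linarith
          · rw [if_neg hy, zero_add]
            exact_mod_cast cyc_pair κ hmul y y' hy
      _ = V.card * q + V.card ^ 2 * h := by
          simp [Finset.sum_add_distrib]
          ring
  have hexp : ∑ x : F, ∑ c : ZMod m, ((nbc κ V x c : ℝ) - V.card / m) ^ 2 =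
      ∑ x : F, ∑ c : ZMod m, (nbc κ V x c : ℝ) ^ 2
      - 2 * (V.card / m) * ∑ x : F, ∑ c : ZMod m, (nbc κ V x c : ℝ)
      + q * m * (V.card / m) ^ 2 := by
    simp_rw [sub_sq, Finset.sum_add_distrib, Finset.sum_sub_distrib, Finset.mul_sum]
    have : ∀ x : F, ∀ c : ZMod m, 2 * (nbc κ V x c : ℝ) * (V.card / m) =
        2 * (V.card / m) * nbc κ V x c := by
      intro x c; ring
    simp_rw [this]
    simp [hq, ZMod.card]
    ring
  have hVq : (V.card : ℝ) ≤ q := by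
    rw [hq]; exact_mod_cast Finset.card_le_univ _
  rw [hexp, hS1]
  have e1 : V.card * q + (V.card : ℝ) ^ 2 * h - 2 * (V.card / m) * (V.card * (q - 1))
      + q * m * (V.card / m) ^ 2 = V.card * q + (V.card : ℝ) ^ 2 / m := by
    rw [← hqh]
    field_simp
    ring
  have hm1 : (1 : ℝ) ≤ m := by exact_mod_cast Nat.one_le_iff_ne_zero.2 (NeZero.ne m)
  have e2 : (V.card : ℝ) ^ 2 / m ≤ V.card * q := by
    rw [div_le_iff₀ hm]
    have hV0 : (0 : ℝ) ≤ V.card := Nat.cast_nonneg _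
    have : (V.card : ℝ) * V.card ≤ V.card * q := mul_le_mul_of_nonneg_left hVq hV0
    have h0 : 0 ≤ (V.card : ℝ) * q := mul_nonneg hV0 (hV0.trans hVq)
    nlinarith
  have hV0 : (0 : ℝ) ≤ V.card := Nat.cast_nonneg _
  nlinarith [mul_nonneg hV0 (hV0.trans hVq)]

open Classical in
theorem cyc_bad {F : Type} [Field F] [Fintype F] {m : ℕ} [NeZero m] (κ : F → ZMod m)
    (hmul : ∀ x y : F, x ≠ 0 → y ≠ 0 → κ (x * y) = κ x + κ y)
    (hker : (Finset.univ.filter fun d : F => d ≠ 0 ∧ κ d = 0).card * m + 1 = Fintype.card F)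
    (V : Finset F) (c : ZMod m) :
    ((Finset.univ.filter fun x : F => (nbc κ V x c : ℝ) < V.card / (2 * m)).card : ℝ) * V.card
      ≤ 12 * m ^ 2 * Fintype.card F := by
  have hm : (0 : ℝ) < m := by exact_mod_cast Nat.pos_of_ne_zero (NeZero.ne m)
  have h := cyc_moment κ hmul hker V
  set S := Finset.univ.filter fun x : F => (nbc κ V x c : ℝ) < V.card / (2 * m) with hS
  have hV0 : (0 : ℝ) ≤ V.card := Nat.cast_nonneg _
  have h1 : (S.card : ℝ) * ((V.card : ℝ) / (2 * m)) ^ 2 ≤ 3 * V.card * Fintype.card F := by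
    refine le_trans ?_ h
    calc (S.card : ℝ) * ((V.card : ℝ) / (2 * m)) ^ 2
        = ∑ x ∈ S, ((V.card : ℝ) / (2 * m)) ^ 2 := by simp
      _ ≤ ∑ x ∈ S, ∑ c : ZMod m, ((nbc κ V x c : ℝ) - V.card / m) ^ 2 := by
          refine Finset.sum_le_sum fun x hx => ?_
          refine le_trans ?_ (Finset.single_le_sum
            (f := fun c => ((nbc κ V x c : ℝ) - V.card / m) ^ 2)
            (fun _ _ => sq_nonneg _) (Finset.mem_univ c))
          have hx' : (nbc κ V x c : ℝ) < V.card / (2 * m) := by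
            simpa [hS] using hx
          have e : (V.card : ℝ) / m = V.card / (2 * m) + V.card / (2 * m) := by
            field_simp; ring
          have h0 : 0 ≤ (V.card : ℝ) / (2 * m) := by positivity
          rw [e]
          nlinarith
      _ ≤ _ := Finset.sum_le_sum_of_subset_of_nonneg (Finset.subset_univ _)
          (fun _ _ _ => Finset.sum_nonneg fun _ _ => sq_nonneg _)
  rcases eq_or_lt_of_le hV0 with h0 | h0
  · rw [← h0]; simp; positivity
  · have e : (S.card : ℝ) * ((V.card : ℝ) / (2 * m)) ^ 2 =
      (S.card * V.card) * V.card / (4 * m ^ 2) := by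
      field_simp; ring
    rw [e, div_le_iff₀ (by positivity)] at h1
    refine le_of_mul_le_mul_right ?_ h0
    linarith

theorem cyc_embed (m : ℕ) [NeZero m] (l : ℕ) : ∀ δ : ℝ, 0 < δ → ∃ N : ℕ,
    ∀ (F : Type) [Field F] [Fintype F] [DecidableEq F] (κ : F → ZMod m),
    (∀ x y : F, x ≠ 0 → y ≠ 0 → κ (x * y) = κ x + κ y) →
    ((Finset.univ.filter fun d : F => d ≠ 0 ∧ κ d = 0).card * m + 1 = Fintype.card F) →
    N ≤ Fintype.card F → ∀ V : Fin l → Finset F, (∀ a, δ * Fintype.card F ≤ (V a).card) →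
    ∀ c : Fin l → Fin l → ZMod m, ∃ f : Fin l → F, (∀ a, f a ∈ V a) ∧
      ∀ a b, a < b → f b ≠ f a ∧ κ (f b - f a) = c a b := by
  classical
  induction l with
  | zero =>
    intro δ _
    exact ⟨0, fun F _ _ _ κ _ _ _ V _ c => ⟨fun a => a.elim0, fun a => a.elim0,
      fun a => a.elim0⟩⟩
  | succ l ih =>
    intro δ hδ
    have hm : (0 : ℝ) < m := by exact_mod_cast Nat.pos_of_ne_zero (NeZero.ne m)
    obtain ⟨N, hN⟩ := ih (δ / (2 * m)) (by positivity)
    obtain ⟨N', hN'⟩ := exists_nat_gt ((l : ℝ) * (12 * m ^ 2 / δ) / δ)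
    refine ⟨max N (max N' 1), ?_⟩
    intro F _ _ _ κ hmul hker hcard V hV c
    have hker' : (Finset.univ.filter fun d : F => d ≠ 0 ∧ κ d = 0).card * m + 1
      = Fintype.card F := hker
    have hq0 : (0 : ℝ) < Fintype.card F := by exact_mod_cast Fintype.card_pos
    have hNq : (N' : ℝ) ≤ Fintype.card F := by
      exact_mod_cast (le_max_left _ _).trans ((le_max_right _ _).trans hcard)
    let bad : Fin l → Finset F := fun b => Finset.univ.filter fun x : F =>
      (nbc κ (V b.succ) x (c 0 b.succ) : ℝ) < (V b.succ).card / (2 * m)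
    have hbad : ∀ b, ((bad b).card : ℝ) ≤ 12 * m ^ 2 / δ := by
      intro b
      have h1 := cyc_bad κ hmul (by convert hker') (V b.succ) (c 0 b.succ)
      have h2 := hV b.succ
      have h3 : ((bad b).card : ℝ) * (V b.succ).card ≤ 12 * m ^ 2 * Fintype.card F := by
        convert h1
      have h4 : ((bad b).card : ℝ) * (δ * Fintype.card F) ≤ 12 * m ^ 2 * Fintype.card F :=
        le_trans (mul_le_mul_of_nonneg_left h2 (Nat.cast_nonneg _)) h3
      rw [le_div_iff₀ hδ]
      refine le_of_mul_le_mul_right ?_ hq0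
      linarith
    have hU : ((Finset.univ.biUnion bad).card : ℝ) < (V 0).card := by
      calc ((Finset.univ.biUnion bad).card : ℝ) ≤ ∑ b, ((bad b).card : ℝ) := by
            exact_mod_cast Finset.card_biUnion_le
        _ ≤ ∑ b : Fin l, (12 * m ^ 2 / δ : ℝ) := Finset.sum_le_sum fun b _ => hbad b
        _ = l * (12 * m ^ 2 / δ) := by simp
        _ < δ * Fintype.card F := by
            rw [div_lt_iff₀ hδ] at hN'
            nlinarith
        _ ≤ (V 0).card := hV 0
    obtain ⟨x, hx, hxb⟩ := Finset.exists_mem_notMem_of_card_lt_card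
      (s := Finset.univ.biUnion bad) (t := V 0) (by exact_mod_cast hU)
    simp only [Finset.mem_biUnion, Finset.mem_univ, true_and, not_exists] at hxb
    obtain ⟨f, hf1, hf2⟩ := hN F κ hmul hker ((le_max_left _ _).trans hcard)
      (fun b => (V b.succ).filter fun y => y ≠ x ∧ κ (y - x) = c 0 b.succ) (by
        intro b
        have h1 := hxb b
        simp only [bad, Finset.mem_filter, Finset.mem_univ, true_and, not_lt] at h1
        have h2 := hV b.succ
        have h3 : (((V b.succ).filter fun y => y ≠ x ∧ κ (y - x) = c 0 b.succ).card : ℝ)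
          = nbc κ (V b.succ) x (c 0 b.succ) := by
          simp only [nbc]
          congr!
        rw [h3]
        refine le_trans ?_ h1
        rw [div_mul_eq_mul_div]
        gcongr) (fun a b => c a.succ b.succ)
    simp only [Finset.mem_filter] at hf1
    refine ⟨Fin.cons x f, ?_, ?_⟩
    · intro a
      refine Fin.cases ?_ (fun a => ?_) a
      · simpa using hx
      · simpa using (hf1 a).1
    · intro a b
      refine Fin.cases ?_ (fun a => ?_) a
      · refine Fin.cases ?_ (fun b => ?_) b
        · intro h; exact absurd h (lt_irrefl _)
        · intro _
          simpa using (hf1 b).2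
      · refine Fin.cases ?_ (fun b => ?_) b
        · intro h
          exact absurd h (Fin.not_lt_zero _)
        · intro h
          simpa using hf2 a b (Fin.succ_lt_succ_iff.1 h)

theorem invol_colour {S : Type} [Fintype S] (P : S → Prop) (σ : S → S) (hσ : ∀ s, σ (σ s) = s)
    (hP : ∀ s, P (σ s) ↔ ¬ P s) (n : ℕ) (hn : 0 < n) (hS : Fintype.card S = 2 * n) :
    ∃ e : S → ZMod (2 * n), Function.Bijective e ∧ ∀ s, e (σ s) = e s + (n : ZMod (2 * n)) := by
  classical
  have h1 : Fintype.card {s // P s} = Fintype.card {s // ¬ P s} := by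
    refine Fintype.card_congr ⟨fun s => ⟨σ s.1, fun h => (hP s.1).1 h s.2⟩,
      fun s => ⟨σ s.1, (hP s.1).2 s.2⟩, fun s => Subtype.ext (hσ _), fun s => Subtype.ext (hσ _)⟩
  have h2 : Fintype.card {s // P s} = n := by
    have := Fintype.card_subtype_compl P
    have h3 := Fintype.card_subtype_le P
    omega
  let e0 : {s // P s} ≃ Fin n := Fintype.equivFinOfCardEq h2
  let e1 : S → ℕ := fun s => if h : P s then e0 ⟨s, h⟩ else e0 ⟨σ s, (hP s).2 h⟩ + n
  have hlt : ∀ s, e1 s < 2 * n := by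
    intro s
    simp only [e1]
    split_ifs with h
    · have := (e0 ⟨s, h⟩).2; omega
    · have := (e0 ⟨σ s, (hP s).2 h⟩).2; omega
  have hinj : Function.Injective e1 := by
    intro s t h
    simp only [e1] at h
    split_ifs at h with h1 h2 h2
    · have := e0.injective (Fin.ext h)
      simpa using this
    · have := (e0 ⟨s, h1⟩).2; omega
    · have := (e0 ⟨t, h2⟩).2; omega
    · have := e0.injective (Fin.ext (Nat.add_right_cancel h))
      simp only [Subtype.mk.injEq] at this
      rw [← hσ s, this, hσ]
  have : NeZero (2 * n) := ⟨by omega⟩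
  refine ⟨fun s => (e1 s : ZMod (2 * n)), ?_, ?_⟩
  · rw [Fintype.bijective_iff_injective_and_card]
    refine ⟨?_, by rw [hS, ZMod.card]⟩
    intro s t h
    apply hinj
    have h' := (ZMod.natCast_eq_natCast_iff' _ _ _).1 h
    rwa [Nat.mod_eq_of_lt (hlt s), Nat.mod_eq_of_lt (hlt t)] at h'
  · intro s
    have h0 : (n : ZMod (2 * n)) + n = 0 := by
      rw [← Nat.cast_add, ← two_mul]
      exact ZMod.natCast_self _
    by_cases h : P s
    · have h' : ¬ P (σ s) := fun h' => (hP s).1 h' h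
      simp only [e1, h, h', dif_pos, dif_neg, not_false_eq_true, hσ]
      push_cast
      rfl
    · have h' : P (σ s) := (hP s).2 h
      simp only [e1, h, h', dif_pos, dif_neg, not_false_eq_true]
      push_cast
      rw [add_assoc, h0, add_zero]

theorem exists_colouring {k n : ℕ} (hn : 0 < n) {I Θ : Type} [LinearOrder I] [Fintype Θ]
    (φ : Θ → Fin k → Option I)
    (h3 : ∀ i j : I, Nat.card {s : Θ × Fin k × Fin k // s.2.1 ≠ s.2.2 ∧ φ s.1 s.2.1 = some i ∧
      φ s.1 s.2.2 = some j} = 2 * n) :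
    ∃ col : Θ → Fin k → Fin k → ZMod (2 * n),
      (∀ θ a b, a ≠ b → φ θ a ≠ none → φ θ b ≠ none → col θ b a = col θ a b + (n : ZMod (2 * n))) ∧
      ∀ i j c, ∃! s : Θ × Fin k × Fin k, s.2.1 ≠ s.2.2 ∧ φ s.1 s.2.1 = some i ∧
        φ s.1 s.2.2 = some j ∧ col s.1 s.2.1 s.2.2 = c := by
  classical
  have h0 : (n : ZMod (2 * n)) + n = 0 := by
    rw [← Nat.cast_add, ← two_mul]
    exact ZMod.natCast_self _
  have : NeZero (2 * n) := ⟨by omega⟩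
  let M : I → I → Θ × Fin k × Fin k → Prop := fun i j s =>
    s.2.1 ≠ s.2.2 ∧ φ s.1 s.2.1 = some i ∧ φ s.1 s.2.2 = some j
  have A : ∀ i j : I, i ≤ j → ∃ col : Θ × Fin k × Fin k → ZMod (2 * n),
      (∀ θ a b, (M i j (θ, a, b) ∨ M j i (θ, a, b)) →
        col (θ, b, a) = col (θ, a, b) + (n : ZMod (2 * n))) ∧
      (∀ c, ∃! s, M i j s ∧ col s = c) ∧ (∀ c, ∃! s, M j i s ∧ col s = c) := by
    intro i j hij
    have hcard : Fintype.card {s // M i j s} = 2 * n := by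
      rw [← Nat.card_eq_fintype_card]; exact h3 i j
    rcases eq_or_lt_of_le hij with rfl | hij
    · obtain ⟨e, he, he'⟩ := invol_colour (S := {s // M i i s}) (fun s => s.1.2.1 < s.1.2.2)
        (fun s => ⟨(s.1.1, s.1.2.2, s.1.2.1), s.2.1.symm, s.2.2.2, s.2.2.1⟩)
        (fun s => rfl) (fun s => by
          have := s.2.1
          constructor
          · intro h h'; exact lt_asymm h h'
          · intro h; exact lt_of_le_of_ne (not_lt.1 h) this.symm) n hn hcard
      have B : ∀ c, ∃! s, M i i s ∧ (if h : M i i s then e ⟨s, h⟩ else 0) = c := by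
        intro c
        obtain ⟨s, hs⟩ := he.2 c
        refine ⟨s.1, ⟨s.2, by rw [dif_pos s.2]; exact hs⟩, ?_⟩
        rintro t ⟨ht, ht'⟩
        rw [dif_pos ht, ← hs] at ht'
        exact congrArg Subtype.val (he.1 ht')
      refine ⟨fun s => if h : M i i s then e ⟨s, h⟩ else 0, ?_, B, B⟩
      intro θ a b h
      have h : M i i (θ, a, b) := by simpa using h
      have h' : M i i (θ, b, a) := ⟨h.1.symm, h.2.2, h.2.1⟩
      beta_reduce
      rw [dif_pos h, dif_pos h']
      exact he' ⟨_, h⟩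
    · let e : {s // M i j s} ≃ ZMod (2 * n) := Fintype.equivOfCardEq (by rw [hcard, ZMod.card])
      have hnot : ∀ s, M j i s → ¬ M i j s := by
        rintro s ⟨_, h1, _⟩ ⟨_, h2, _⟩
        rw [h1] at h2
        exact hij.ne (Option.some.inj h2).symm
      have hsw : ∀ θ a b, M j i (θ, a, b) → M i j (θ, b, a) :=
        fun θ a b h => ⟨h.1.symm, h.2.2, h.2.1⟩
      have hsw' : ∀ θ a b, M i j (θ, a, b) → M j i (θ, b, a) :=
        fun θ a b h => ⟨h.1.symm, h.2.2, h.2.1⟩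
      let col : Θ × Fin k × Fin k → ZMod (2 * n) := fun s =>
        if h : M i j s then e ⟨s, h⟩ else
          if h : M i j (s.1, s.2.2, s.2.1) then e ⟨_, h⟩ + (n : ZMod (2 * n)) else 0
      have c1 : ∀ s (h : M i j s), col s = e ⟨s, h⟩ := by
        intro s h
        simp only [col]
        rw [dif_pos h]
      have c2 : ∀ θ a b (h : M j i (θ, a, b)), col (θ, a, b) =
          e ⟨_, hsw θ a b h⟩ + (n : ZMod (2 * n)) := by
        intro θ a b h
        simp only [col]
        rw [dif_neg (hnot _ h), dif_pos (hsw θ a b h)]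
      refine ⟨col, ?_, ?_, ?_⟩
      · rintro θ a b (h | h)
        · rw [c1 _ h, c2 _ _ _ (hsw' _ _ _ h)]
        · rw [c2 _ _ _ h, c1 _ (hsw _ _ _ h), add_assoc, h0, add_zero]
      · intro c
        refine ⟨(e.symm c).1, ⟨(e.symm c).2, by rw [c1 _ (e.symm c).2]; simp⟩, ?_⟩
        rintro t ⟨ht, ht'⟩
        rw [c1 _ ht] at ht'
        rw [← ht']
        simp
      · intro c
        obtain ⟨⟨⟨θ, a, b⟩, hs⟩, hs'⟩ := e.surjective (c - n)
        refine ⟨(θ, b, a), ⟨hsw' _ _ _ hs, ?_⟩, ?_⟩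
        · rw [c2 _ _ _ (hsw' _ _ _ hs), hs']
          ring
        · rintro ⟨θ', a', b'⟩ ⟨ht, ht'⟩
          rw [c2 _ _ _ ht] at ht'
          have := e.injective (hs'.trans (eq_sub_of_add_eq ht').symm)
          simp only [Subtype.mk.injEq, Prod.mk.injEq] at this
          obtain ⟨rfl, rfl, rfl⟩ := this
          rfl
  choose! C hC1 hC2 hC3 using A
  let col : Θ → Fin k → Fin k → ZMod (2 * n) := fun θ a b =>
    match φ θ a, φ θ b with
    | some i, some j => C (min i j) (max i j) (θ, a, b)
    | _, _ => 0
  have hcol : ∀ θ a b i j, φ θ a = some i → φ θ b = some j →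
      col θ a b = C (min i j) (max i j) (θ, a, b) := by
    intro θ a b i j hi hj
    simp only [col, hi, hj]
  refine ⟨col, ?_, ?_⟩
  · intro θ a b hab ha hb
    obtain ⟨i, hi⟩ := Option.ne_none_iff_exists'.1 ha
    obtain ⟨j, hj⟩ := Option.ne_none_iff_exists'.1 hb
    rw [hcol θ a b i j hi hj, hcol θ b a j i hj hi, min_comm j i, max_comm j i]
    apply hC1 _ _ min_le_max
    rcases le_total i j with h | h
    · left; rw [min_eq_left h, max_eq_right h]; exact ⟨hab, hi, hj⟩
    · right; rw [min_eq_right h, max_eq_left h]; exact ⟨hab, hi, hj⟩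
  · intro i j c
    have key : ∃! s, M i j s ∧ C (min i j) (max i j) s = c := by
      rcases le_total i j with h | h
      · rw [min_eq_left h, max_eq_right h]; exact hC2 _ _ h c
      · rw [min_eq_right h, max_eq_left h]; exact hC3 _ _ h c
    obtain ⟨s, ⟨hs, hs'⟩, hu⟩ := key
    refine ⟨s, ⟨hs.1, hs.2.1, hs.2.2, ?_⟩, ?_⟩
    · rw [hcol _ _ _ i j hs.2.1 hs.2.2]; exact hs'
    · rintro t ⟨t1, t2, t3, t4⟩
      rw [hcol _ _ _ i j t2 t3] at t4
      exact hu t ⟨⟨t1, t2, t3⟩, t4⟩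

theorem exists_kappa {p n h : ℕ} (hp : p.Prime) (hn : 0 < n) (hodd : Odd h)
    (hph : p = 1 + 2 * n * h) :
    ∃ κ : ZMod p → ZMod (2 * n),
      (∀ x y : ZMod p, x ≠ 0 → y ≠ 0 → κ (x * y) = κ x + κ y) ∧
      Nat.card {d : ZMod p // d ≠ 0 ∧ κ d = 0} = h ∧ κ (-1) = (n : ZMod (2 * n)) := by
  classical
  have : Fact p.Prime := ⟨hp⟩
  have : NeZero (2 * n) := ⟨by omega⟩
  have hcard : Nat.card (ZMod p)ˣ = 2 * n * h := by
    rw [Nat.card_eq_fintype_card, ZMod.card_units]; omega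
  have hh : 0 < h := hodd.pos
  let e : Multiplicative (ZMod (2 * n * h)) ≃* (ZMod p)ˣ :=
    hcard ▸ zmodCyclicMulEquiv (G := (ZMod p)ˣ) inferInstance
  let ψ : (ZMod p)ˣ →* Multiplicative (ZMod (2 * n)) :=
    (AddMonoidHom.toMultiplicative
      (ZMod.castHom (Dvd.intro h rfl) (ZMod (2 * n))).toAddMonoidHom).comp e.symm.toMonoidHom
  have hψ : ∀ u, ψ u = Multiplicative.ofAdd
      (ZMod.castHom (Dvd.intro h rfl) (ZMod (2 * n)) (Multiplicative.toAdd (e.symm u))) :=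
    fun u => rfl
  have hsurj : Function.Surjective ψ := by
    intro c
    obtain ⟨d, hd⟩ := ZMod.castHom_surjective (Dvd.intro h rfl : 2 * n ∣ 2 * n * h)
      (Multiplicative.toAdd c)
    refine ⟨e (Multiplicative.ofAdd d), ?_⟩
    rw [hψ]
    simp [hd]
  let κ : ZMod p → ZMod (2 * n) := fun d =>
    if h : d ≠ 0 then Multiplicative.toAdd (ψ (Units.mk0 d h)) else 0
  have hκ : ∀ d (h : d ≠ 0), κ d = Multiplicative.toAdd (ψ (Units.mk0 d h)) := by
    intro d h
    simp only [κ]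
    rw [dif_pos h]
  refine ⟨κ, ?_, ?_, ?_⟩
  · intro x y hx hy
    rw [hκ _ hx, hκ _ hy, hκ _ (mul_ne_zero hx hy), Units.mk0_mul, map_mul]
    rfl
  · have h1 : Nat.card ψ.ker = h := by
      have h2 := Subgroup.card_mul_index ψ.ker
      rw [Subgroup.index_ker, MonoidHom.range_eq_top.2 hsurj, hcard] at h2
      have h3 : Nat.card (⊤ : Subgroup (Multiplicative (ZMod (2 * n)))) = 2 * n := by
        rw [Subgroup.card_top, Nat.card_eq_fintype_card, Fintype.card_multiplicative, ZMod.card]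
      rw [h3, mul_comm] at h2
      exact Nat.eq_of_mul_eq_mul_left (by omega) h2
    rw [← h1]
    refine Nat.card_congr ⟨fun d => ⟨Units.mk0 d.1 d.2.1, ?_⟩, fun u => ⟨u.1, u.1.ne_zero, ?_⟩,
      ?_, ?_⟩
    · have := d.2.2
      rw [hκ _ d.2.1] at this
      rw [MonoidHom.mem_ker]
      exact Multiplicative.toAdd.injective this
    · rw [hκ _ u.1.ne_zero, Units.mk0_val, MonoidHom.mem_ker.1 u.2]
      rfl
    · intro d; rfl
    · intro u
      apply Subtype.ext
      simp
  · rw [hκ _ (neg_ne_zero.2 one_ne_zero), hψ]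
    set x := Multiplicative.toAdd (e.symm (Units.mk0 (-1 : ZMod p) (neg_ne_zero.2 one_ne_zero)))
      with hx
    have : NeZero (2 * n * h) := ⟨by positivity⟩
    have hx2 : x + x = 0 := by
      rw [hx, ← toAdd_mul, ← map_mul]
      have : Units.mk0 (-1 : ZMod p) (neg_ne_zero.2 one_ne_zero) *
        Units.mk0 (-1 : ZMod p) (neg_ne_zero.2 one_ne_zero) = 1 := by
        apply Units.ext; simp
      rw [this]; simp
    have hx0 : x ≠ 0 := by
      intro h0
      have h1 : e.symm (Units.mk0 (-1 : ZMod p) (neg_ne_zero.2 one_ne_zero)) = 1 :=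
        Multiplicative.toAdd.injective (hx.symm.trans h0)
      have h2 : Units.mk0 (-1 : ZMod p) (neg_ne_zero.2 one_ne_zero) = 1 := by
        simpa using h1
      have h3 : (-1 : ZMod p) = 1 := by simpa using congrArg Units.val h2
      have : Fact (2 < p) := ⟨by
        have : 1 ≤ n * h := Nat.mul_pos hn hh
        rw [hph, mul_assoc]; omega⟩
      exact ZMod.neg_one_ne_one h3
    have hval : x.val = n * h := by
      have h1 : ((x.val + x.val : ℕ) : ZMod (2 * n * h)) = 0 := by
        push_cast
        simpa using hx2
      rw [ZMod.natCast_eq_zero_iff] at h1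
      obtain ⟨c, hc⟩ := h1
      have h2 := ZMod.val_lt x
      have h3 : 0 < x.val := Nat.pos_of_ne_zero fun h => hx0 ((ZMod.val_eq_zero x).1 h)
      have hc1 : c = 1 := by
        have : 0 < c := Nat.pos_of_ne_zero fun h => by subst h; omega
        have : c < 2 := by
          by_contra hc2
          have : 2 * n * h * 2 ≤ 2 * n * h * c := Nat.mul_le_mul_left _ (by omega)
          omega
        omega
      subst hc1
      have h4 : 2 * n * h = 2 * (n * h) := by ring
      omega
    have hxe : x = ((n * h : ℕ) : ZMod (2 * n * h)) := by
      rw [← hval]; simp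
    rw [hxe, toAdd_ofAdd, map_natCast]
    obtain ⟨r, rfl⟩ := hodd
    have : ((2 * n : ℕ) : ZMod (2 * n)) = 0 := ZMod.natCast_self _
    push_cast at this ⊢
    linear_combination (r : ZMod (2 * n)) * this

theorem cyc_gdd {k n : ℕ} (hn : 0 < n) {I Θ Wt : Type} [LinearOrder I] [Fintype I] [Fintype Θ]
    [Fintype Wt] (φ : Θ → Fin k → Option I) (ω : ∀ θ, (∃ b, φ θ b = none) → Wt)
    (h1 : ∀ θ a b, φ θ a = none → φ θ b = none → a = b)
    (h2 : ∀ w i, ∃! s : Θ × Fin k, (∃ hb, ω s.1 hb = w) ∧ φ s.1 s.2 = some i)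
    (h3 : ∀ i j : I, Nat.card {s : Θ × Fin k × Fin k // s.2.1 ≠ s.2.2 ∧ φ s.1 s.2.1 = some i ∧
      φ s.1 s.2.2 = some j} = 2 * n) :
    ∃ N : ℕ, ∀ p h : ℕ, p.Prime → N ≤ p → Odd h → p = 1 + 2 * n * h →
      DD k p (Fintype.card I) (Fintype.card Wt * h) := by
  classical
  have : NeZero (2 * n) := ⟨by omega⟩
  obtain ⟨col, hcol1, hcol2⟩ := exists_colouring hn φ h3
  obtain ⟨N, hN⟩ := cyc_embed (2 * n) k 1 one_pos
  refine ⟨N, ?_⟩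
  intro p h hp hNp hodd hph
  have : Fact p.Prime := ⟨hp⟩
  obtain ⟨κ, hmul, hker, hneg⟩ := exists_kappa hp hn hodd hph
  have hex : ∀ θ, ∃ f : Fin k → ZMod p, ∀ a b, a < b → f b ≠ f a ∧ κ (f b - f a) = col θ a b := by
    intro θ
    obtain ⟨f, _, hf⟩ := hN (ZMod p) κ hmul (by
      rw [ZMod.card]
      rw [Nat.card_eq_fintype_card, Fintype.card_subtype] at hker
      rw [hker, hph]
      ring) (by rwa [ZMod.card]) (fun _ => Finset.univ) (by simp) (col θ)
    exact ⟨f, hf⟩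
  choose f hf using hex
  have hfne : ∀ θ a b, a ≠ b → f θ a ≠ f θ b := by
    intro θ a b hab
    rcases lt_or_gt_of_ne hab with h | h
    · exact (hf θ a b h).1.symm
    · exact (hf θ b a h).1
  have hfκ : ∀ θ a b, a ≠ b → φ θ a ≠ none → φ θ b ≠ none →
      κ (f θ b - f θ a) = col θ a b := by
    intro θ a b hab ha hb
    rcases lt_or_gt_of_ne hab with h | h
    · exact (hf θ a b h).2
    · have e1 : f θ b - f θ a = (-1) * (f θ a - f θ b) := by ring
      rw [e1, hmul _ _ (neg_ne_zero.2 one_ne_zero) (sub_ne_zero.2 (hfne θ a b hab)), hneg,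
        (hf θ b a h).2, hcol1 θ b a hab.symm hb ha, add_comm]
  let H : Type := {d : ZMod p // d ≠ 0 ∧ κ d = 0}
  let pt : Θ × H × ZMod p → Fin k → (ZMod p × I) ⊕ (Wt × H) := fun s a =>
    if h : φ s.1 a = none then Sum.inr (ω s.1 ⟨a, h⟩, s.2.1)
    else Sum.inl (s.2.1.1 * f s.1 a + s.2.2, (φ s.1 a).get (Option.isSome_iff_ne_none.2 h))
  have pt_some : ∀ θ d z a i, φ θ a = some i → pt (θ, d, z) a = Sum.inl (d.1 * f θ a + z, i) := by
    intro θ d z a i h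
    simp [pt, h]
  have pt_none : ∀ θ d z a (h : φ θ a = none), pt (θ, d, z) a = Sum.inr (ω θ ⟨a, h⟩, d) := by
    intro θ d z a h
    simp only [pt]
    rw [dif_pos h]
  have key : Dec k (GR (ZMod p) I (fun _ _ : Wt × H => False)) := by
    refine Dec.of_family pt ?_ ?_ ?_ ?_
    · rintro ⟨θ, d, z⟩ a b hab
      by_contra hne
      rcases ha : φ θ a with _ | i <;> rcases hb : φ θ b with _ | j
      · exact absurd (h1 θ a b ha hb) hne
      · rw [pt_none _ _ _ _ ha, pt_some _ _ _ _ _ hb] at hab; simp at hab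
      · rw [pt_none _ _ _ _ hb, pt_some _ _ _ _ _ ha] at hab; simp at hab
      · rw [pt_some _ _ _ _ _ hb, pt_some _ _ _ _ _ ha] at hab
        simp [d.2.1, hfne θ a b hne] at hab
    · rintro ⟨θ, d, z⟩ a b hne
      rcases ha : φ θ a with _ | i <;> rcases hb : φ θ b with _ | j
      · exact absurd (h1 θ a b ha hb) hne
      · rw [pt_none _ _ _ _ ha, pt_some _ _ _ _ _ hb]; simp [GR]
      · rw [pt_none _ _ _ _ hb, pt_some _ _ _ _ _ ha]; simp [GR]
      · rw [pt_some _ _ _ _ _ hb, pt_some _ _ _ _ _ ha]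
        simp [GR, d.2.1, hfne θ a b hne]
    · rintro (⟨x, i⟩ | ⟨w, d⟩) (⟨y, j⟩ | ⟨w', d'⟩) hxy
      · have hxy : x ≠ y := hxy
        obtain ⟨⟨θ, a, b⟩, ⟨hab, ha, hb, hc⟩, _⟩ := hcol2 i j (κ (y - x))
        simp only at hab ha hb hc
        have hF : f θ b - f θ a ≠ 0 := sub_ne_zero.2 (hfne θ b a hab.symm)
        have hyx : y - x ≠ 0 := sub_ne_zero.2 hxy.symm
        have hd0 : (y - x) / (f θ b - f θ a) ≠ 0 := div_ne_zero hyx hF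
        have hdm : (y - x) / (f θ b - f θ a) * (f θ b - f θ a) = y - x := div_mul_cancel₀ _ hF
        have hdκ : κ ((y - x) / (f θ b - f θ a)) = 0 := by
          have := hmul _ _ hd0 hF
          rw [hdm, hfκ θ a b hab (by simp [ha]) (by simp [hb]), hc] at this
          simpa using this.symm
        refine ⟨(θ, ⟨_, hd0, hdκ⟩, x - (y - x) / (f θ b - f θ a) * f θ a), a, b, ?_, ?_⟩
        · rw [pt_some _ _ _ _ _ ha]; simp
        · rw [pt_some _ _ _ _ _ hb]
          have : (y - x) / (f θ b - f θ a) * f θ b + (x - (y - x) / (f θ b - f θ a) * f θ a) = y := by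
            linear_combination hdm
          simp only [this]
      · obtain ⟨⟨θ, a⟩, ⟨⟨⟨b, hb⟩, hw⟩, ha⟩, _⟩ := h2 w' i
        refine ⟨(θ, d', x - d'.1 * f θ a), a, b, ?_, ?_⟩
        · rw [pt_some _ _ _ _ _ ha]; simp
        · rw [pt_none _ _ _ _ hb]; rw [← hw]
      · obtain ⟨⟨θ, a⟩, ⟨⟨⟨b, hb⟩, hw⟩, ha⟩, _⟩ := h2 w j
        refine ⟨(θ, d, y - d.1 * f θ a), b, a, ?_, ?_⟩
        · rw [pt_none _ _ _ _ hb]; rw [← hw]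
        · rw [pt_some _ _ _ _ _ ha]; simp
      · exact hxy.elim
    · have mixed : ∀ θ d z θ' d' z' a b a' b', (φ θ b = none) →
          pt (θ, d, z) a = pt (θ', d', z') a' → pt (θ, d, z) b = pt (θ', d', z') b' → a ≠ b →
          ((θ, d, z) : Θ × H × ZMod p) = (θ', d', z') := by
        intro θ d z θ' d' z' a b a' b' hb e1 e2 hab
        rcases hb' : φ θ' b' with _ | j
        · rcases ha : φ θ a with _ | i
          · exact absurd (h1 θ a b ha hb) hab
          · rcases ha' : φ θ' a' with _ | i'
            · rw [pt_some _ _ _ _ _ ha, pt_none _ _ _ _ ha'] at e1; simp at e1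
            · rw [pt_some _ _ _ _ _ ha, pt_some _ _ _ _ _ ha'] at e1
              rw [pt_none _ _ _ _ hb, pt_none _ _ _ _ hb'] at e2
              simp only [Sum.inl.injEq, Sum.inr.injEq, Prod.mk.injEq] at e1 e2
              obtain ⟨e1, rfl⟩ := e1
              obtain ⟨e2, rfl⟩ := e2
              have := (h2 (ω θ ⟨b, hb⟩) i).unique (y₁ := (θ, a)) (y₂ := (θ', a'))
                ⟨⟨⟨b, hb⟩, rfl⟩, ha⟩ ⟨⟨⟨b', hb'⟩, e2.symm⟩, ha'⟩
              simp only [Prod.mk.injEq] at this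
              obtain ⟨rfl, rfl⟩ := this
              rw [add_left_cancel e1]
        · rw [pt_none _ _ _ _ hb, pt_some _ _ _ _ _ hb'] at e2; simp at e2
      rintro ⟨θ, d, z⟩ ⟨θ', d', z'⟩ a b a' b' hab e1 e2
      rcases hb : φ θ b with _ | j
      · exact mixed _ _ _ _ _ _ _ _ _ _ hb e1 e2 hab
      rcases ha : φ θ a with _ | i
      · exact mixed _ _ _ _ _ _ _ _ _ _ ha e2 e1 hab.symm
      rcases hb' : φ θ' b' with _ | j'
      · rw [pt_some _ _ _ _ _ hb, pt_none _ _ _ _ hb'] at e2; simp at e2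
      rcases ha' : φ θ' a' with _ | i'
      · rw [pt_some _ _ _ _ _ ha, pt_none _ _ _ _ ha'] at e1; simp at e1
      rw [pt_some _ _ _ _ _ ha, pt_some _ _ _ _ _ ha'] at e1
      rw [pt_some _ _ _ _ _ hb, pt_some _ _ _ _ _ hb'] at e2
      simp only [Sum.inl.injEq, Prod.mk.injEq] at e1 e2
      obtain ⟨e1, rfl⟩ := e1
      obtain ⟨e2, rfl⟩ := e2
      have hF : f θ b - f θ a ≠ 0 := sub_ne_zero.2 (hfne θ b a hab.symm)
      have e3 : d.1 * (f θ b - f θ a) = d'.1 * (f θ' b' - f θ' a') := by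
        linear_combination e2 - e1
      have hab' : a' ≠ b' := by
        rintro rfl
        rw [sub_self, mul_zero] at e3
        exact mul_ne_zero d.2.1 hF e3
      have hF' : f θ' b' - f θ' a' ≠ 0 := sub_ne_zero.2 (hfne θ' b' a' hab'.symm)
      have e4 := congrArg κ e3
      rw [hmul _ _ d.2.1 hF, hmul _ _ d'.2.1 hF', d.2.2, d'.2.2, zero_add, zero_add,
        hfκ θ a b hab (by simp [ha]) (by simp [hb]),
        hfκ θ' a' b' hab' (by simp [ha']) (by simp [hb'])] at e4
      have := (hcol2 i j (col θ a b)).unique (y₁ := (θ, a, b)) (y₂ := (θ', a', b'))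
        ⟨hab, ha, hb, rfl⟩ ⟨hab', ha', hb', e4.symm⟩
      simp only [Prod.mk.injEq] at this
      obtain ⟨rfl, rfl, rfl⟩ := this
      have hd : d = d' := Subtype.ext (mul_right_cancel₀ hF e3)
      subst hd
      rw [add_left_cancel e1]
  have hcH : Fintype.card H = h := by rw [← Nat.card_eq_fintype_card]; exact hker
  exact DD.ofTypes key (ZMod.card p) rfl (by rw [Fintype.card_prod, hcH])

/-- Number of ordered pairs of positions of `φ` carrying `(i, j)`. -/
def pcount {k : ℕ} {I : Type} [DecidableEq I] (φ : Fin k → I) (i j : I) : ℕ :=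
  ∑ s : Fin k × Fin k, if s.1 ≠ s.2 ∧ φ s.1 = i ∧ φ s.2 = j then 1 else 0

theorem pcount_total (k : ℕ) (hk : 2 ≤ k) (I : Type) [Fintype I] [DecidableEq I] [Nonempty I] :
    ∃ β : ℕ, 0 < β ∧ ∀ i j : I, ∑ φ : Fin k → I, pcount φ i j = β := by
  refine ⟨∑ s : Fin k × Fin k, if s.1 ≠ s.2 then
    ∏ x : Fin k, (if x = s.1 then 1 else if x = s.2 then 1 else Fintype.card I) else 0, ?_, ?_⟩
  · apply Finset.sum_pos'
    · intros; exact Nat.zero_le _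
    · refine ⟨(⟨0, by omega⟩, ⟨1, by omega⟩), Finset.mem_univ _, ?_⟩
      rw [if_pos (by simp)]
      apply Finset.prod_pos
      intro x _
      have := Fintype.card_pos (α := I)
      split_ifs <;> omega
  · intro i j
    unfold pcount
    rw [Finset.sum_comm]
    apply Finset.sum_congr rfl
    rintro ⟨a, b⟩ _
    by_cases hab : a = b
    · simp [hab]
    · simp only [ne_eq, hab, not_false_eq_true, true_and, if_true]
      rw [← Finset.card_filter]
      have : (Finset.univ.filter fun φ : Fin k → I => φ a = i ∧ φ b = j) =
          Fintype.piFinset (fun x => if x = a then {i} else if x = b then {j} else Finset.univ) := by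
        ext φ
        simp only [Finset.mem_filter, Finset.mem_univ, true_and, Fintype.mem_piFinset]
        constructor
        · rintro ⟨h1, h2⟩ x
          split_ifs with h h'
          · simp [h, h1]
          · simp [h', h2]
          · simp
        · intro h
          have h1 := h a
          have h2 := h b
          rw [if_pos rfl] at h1
          rw [if_neg (Ne.symm hab), if_pos rfl] at h2
          exact ⟨Finset.mem_singleton.1 h1, Finset.mem_singleton.1 h2⟩
      rw [this, Fintype.card_piFinset]
      apply Finset.prod_congr rfl
      intro x _
      split_ifs <;> simp

theorem pcount_eq {k : ℕ} {I : Type} [DecidableEq I] (φ : Fin k → I) (i j : I) :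
    (pcount φ i j : ℤ) = (∑ a, if φ a = i then (1:ℤ) else 0) * (∑ a, if φ a = j then (1:ℤ) else 0)
      - if i = j then (∑ a, if φ a = i then (1:ℤ) else 0) else 0 := by
  unfold pcount
  push_cast
  rw [Fintype.sum_prod_type, Finset.sum_mul_sum]
  have : (if i = j then (∑ a, if φ a = i then (1:ℤ) else 0) else 0) =
      ∑ a, ∑ b, if a = b ∧ φ a = i ∧ φ b = j then (1:ℤ) else 0 := by
    split_ifs with h
    · subst h
      apply Finset.sum_congr rfl
      intro a _
      rw [Finset.sum_eq_single a]
      · simp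
      · intro b _ hb
        rw [if_neg (fun h => hb h.1.symm)]
      · simp
    · symm
      apply Finset.sum_eq_zero
      intro a _
      apply Finset.sum_eq_zero
      intro b _
      rw [if_neg]
      rintro ⟨rfl, rfl, h'⟩
      exact h h'
  rw [this, ← Finset.sum_sub_distrib]
  apply Finset.sum_congr rfl
  intro a _
  rw [← Finset.sum_sub_distrib]
  apply Finset.sum_congr rfl
  intro b _
  by_cases h1 : a = b <;> by_cases h2 : φ a = i <;> by_cases h3 : φ b = j <;> simp [h1, h2, h3]

/-- The vector of pair counts. -/
def pvec {k : ℕ} {I : Type} [DecidableEq I] (φ : Fin k → I) : I → I → ℤ :=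
  fun i j => (pcount φ i j : ℤ)

theorem pvec_const {K : ℕ} {I : Type} [DecidableEq I] (i x y : I) :
    pvec (fun _ : Fin (K+1) => i) x y = (K * (K+1) : ℤ) * if (x = i ∧ y = i) then 1 else 0 := by
  unfold pvec
  rw [pcount_eq]
  by_cases h1 : x = i
  · subst h1
    by_cases h2 : y = x
    · subst h2
      simp; ring
    · have h3 : x ≠ y := fun h => h2 h.symm
      simp [h2, h3]
  · have h3 : i ≠ x := fun h => h1 h.symm
    simp [h1, h3]

theorem pvec_two {K : ℕ} {I : Type} [DecidableEq I] (i i' : I) (h : i ≠ i') (x y : I) :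
    pvec (Fin.cons i' (fun _ => i) : Fin (K+1) → I) x y =
      (K : ℤ) * ((if x = i ∧ y = i' then 1 else 0) + (if x = i' ∧ y = i then 1 else 0)) +
      (K * (K-1) : ℤ) * if (x = i ∧ y = i) then 1 else 0 := by
  unfold pvec
  rw [pcount_eq]
  simp only [Fin.sum_univ_succ, Fin.cons_zero, Fin.cons_succ, Finset.sum_const, Finset.card_univ,
    Fintype.card_fin, nsmul_eq_mul]
  by_cases h1 : i = x
  · subst h1
    have h' := h.symm
    by_cases h2 : i = y
    · subst h2
      simp [h, h']; ring
    · by_cases h3 : i' = y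
      · subst h3
        simp [h, h']
      · have h2' := Ne.symm h2
        have h3' := Ne.symm h3
        simp [*]
  · have h1' := Ne.symm h1
    by_cases h3 : i' = x
    · subst h3
      by_cases h2 : i = y
      · subst h2
        simp [h, h.symm]
      · have h2' := Ne.symm h2
        by_cases h4 : i' = y
        · simp [*]
        · have h4' := Ne.symm h4
          simp [*]
    · have h3' := Ne.symm h3
      simp [*]

/-- The adjacency of the partition given by `part`. -/
def padj {K : ℕ} {I J : Type} [Fintype J] [DecidableEq I] (part : J → Fin K → I) (x y : I) : ℕ :=
  ∑ c, pcount (part c) x y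

theorem pcount_inj {K : ℕ} {I : Type} [DecidableEq I] (φ : Fin K → I) (x y : I) :
    (pcount φ x y : ℤ) = ∑ s : Fin K × Fin K, if s.1 < s.2 then
      ((if x = φ s.1 ∧ y = φ s.2 then 1 else 0) + (if x = φ s.2 ∧ y = φ s.1 then 1 else 0) : ℤ)
      else 0 := by
  unfold pcount
  push_cast
  have e : ∀ s : Fin K × Fin K, (if s.1 ≠ s.2 ∧ φ s.1 = x ∧ φ s.2 = y then (1:ℤ) else 0) =
     (if s.1 < s.2 then (if x = φ s.1 ∧ y = φ s.2 then 1 else 0) else 0) +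
     (if s.2 < s.1 then (if x = φ s.1 ∧ y = φ s.2 then 1 else 0) else 0) := by
    rintro ⟨a, b⟩
    have hx : ∀ z, (x = z) = (z = x) := fun z => propext eq_comm
    have hy : ∀ z, (y = z) = (z = y) := fun z => propext eq_comm
    simp only [hx, hy]
    rcases lt_trichotomy a b with h | h | h
    · simp [h, h.ne, h.le]
    · simp [h]
    · simp [h, h.ne', h.le]
  rw [Finset.sum_congr rfl (fun s _ => e s), Finset.sum_add_distrib]
  rw [← Equiv.sum_comp (Equiv.prodComm (Fin K) (Fin K)) (fun s =>
    (if s.2 < s.1 then (if x = φ s.1 ∧ y = φ s.2 then (1:ℤ) else 0) else 0)),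
    ← Finset.sum_add_distrib]
  apply Finset.sum_congr rfl
  rintro ⟨a, b⟩ _
  simp only [Equiv.prodComm_apply, Prod.swap]
  by_cases h1 : a < b
  · simp only [h1, if_true]
    congr
  · simp [h1]

theorem pvec_span {K : ℕ} {I J : Type} [Fintype I] [Fintype J] [DecidableEq I]
    (part : J → Fin K → I) (hinj : ∀ c, Function.Injective (part c))
    (hJ : K + 1 ∣ Fintype.card J) [Nonempty I] :
    ∃ ν : (Fin (K+1) → I) → ℤ, ∀ x y, ∑ φ, ν φ * pcount φ x y = - (K * padj part x y : ℤ) := by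
  let S := Submodule.span ℤ (Set.range (pvec : (Fin (K+1) → I) → I → I → ℤ))
  have hS : ∀ φ, (pvec φ : I → I → ℤ) ∈ S := fun φ => Submodule.subset_span ⟨φ, rfl⟩
  obtain ⟨i0⟩ := (inferInstance : Nonempty I)
  let ℓ : I → I → I → ℤ := fun i x y => if (x = i ∧ y = i) then 1 else 0
  let e : I → I → I → I → ℤ := fun i i' x y => (if x = i ∧ y = i' then 1 else 0) +
    (if x = i' ∧ y = i then 1 else 0)
  have h1 : ((K * (K+1) : ℤ)) • ℓ i0 ∈ S := by
    have := hS (fun _ : Fin (K+1) => i0)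
    convert this using 1
    funext x y
    rw [pvec_const]; rfl
  have h2 : ∀ i i', i ≠ i' → (K:ℤ) • e i i' + (K * (K-1) : ℤ) • ℓ i ∈ S := by
    intro i i' h
    have := hS (Fin.cons i' (fun _ => i))
    convert this using 1
    funext x y
    rw [pvec_two i i' h]; rfl
  have hsymm : ∀ i i', e i i' = e i' i := by
    intro i i'
    funext x y
    simp only [e]
    ring
  have h3 : ∀ i, (K * (K-1) : ℤ) • ℓ i0 - (K * (K-1) : ℤ) • ℓ i ∈ S := by
    intro i
    by_cases h : i = i0
    · subst h; simp
    · have a1 := h2 i i0 h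
      have a2 := h2 i0 i (Ne.symm h)
      rw [hsymm] at a2
      have := S.sub_mem a2 a1
      simpa using this
  have h4 : ∀ i i', i ≠ i' → (K:ℤ) • e i i' + (K * (K-1) : ℤ) • ℓ i0 ∈ S := by
    intro i i' h
    have := S.add_mem (h2 i i' h) (h3 i)
    simpa using this
  let c2 : ℤ := ∑ s : Fin K × Fin K, if s.1 < s.2 then 1 else 0
  have h5 : ∀ c, (K:ℤ) • (pvec (part c)) + (c2 * (K * (K-1))) • ℓ i0 ∈ S := by
    intro c
    have : (K:ℤ) • (pvec (part c)) + (c2 * (K * (K-1))) • ℓ i0 = ∑ s : Fin K × Fin K,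
        if s.1 < s.2 then ((K:ℤ) • e (part c s.1) (part c s.2) + (K * (K-1) : ℤ) • ℓ i0) else 0 := by
      funext x y
      simp only [Pi.add_apply, Pi.smul_apply, Finset.sum_apply, smul_eq_mul, c2, pvec]
      rw [pcount_inj, Finset.mul_sum, Finset.sum_mul, Finset.sum_mul, ← Finset.sum_add_distrib]
      apply Finset.sum_congr rfl
      intro s _
      by_cases h : s.1 < s.2 <;> simp [h, e]
    rw [this]
    apply S.sum_mem
    intro s _
    split_ifs with h
    · exact h4 _ _ (fun h' => h.ne (hinj c h'))
    · exact S.zero_mem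
  have h6 : (K:ℤ) • (fun x y => (padj part x y : ℤ)) ∈ S := by
    have a1 := S.sum_mem (t := Finset.univ) (fun c _ => h5 c)
    obtain ⟨d, hd⟩ := hJ
    have a2 := S.smul_mem (d * c2 * (K-1)) h1
    have := S.sub_mem a1 a2
    convert this using 1
    funext x y
    simp only [Pi.add_apply, Pi.smul_apply, Finset.sum_apply, smul_eq_mul, pvec, Pi.sub_apply,
      padj]
    simp only [Finset.sum_add_distrib, Finset.sum_const, Finset.card_univ, hd, nsmul_eq_mul]
    push_cast
    simp only [Finset.mul_sum]
    ring
  have h7 := S.neg_mem h6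
  obtain ⟨ν, hν⟩ := (Submodule.mem_span_range_iff_exists_fun ℤ).1 h7
  refine ⟨ν, fun x y => ?_⟩
  have := congrFun (congrFun hν x) y
  simpa [Finset.sum_apply, pvec] using this

theorem gdd_of_mu {K n : ℕ} (hn : 0 < n) {I J Wt : Type} [LinearOrder I] [Fintype I] [Fintype J]
    [Fintype Wt] (part : J → Fin K → I)
    (hpart : ∀ (_ : Wt) (i : I), ∃! s : J × Fin K, part s.1 s.2 = i)
    (μ : (Fin (K+1) → I) → ℕ)
    (h : ∀ x y, ∑ φ, μ φ * pcount φ x y + Fintype.card Wt * padj part x y = 2 * n) :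
    ∃ N : ℕ, ∀ p h : ℕ, p.Prime → N ≤ p → Odd h → p = 1 + 2 * n * h →
      DD (K+1) p (Fintype.card I) (Fintype.card Wt * h) := by
  classical
  let Θ := (Σ φ : Fin (K+1) → I, Fin (μ φ)) ⊕ (Wt × J)
  let Φ : Θ → Fin (K+1) → Option I := Sum.elim (fun t a => some (t.1 a))
    (fun t => Fin.cons none (fun a => some (part t.2 a)))
  have hnone : ∀ t, ¬ ∃ b, Φ (Sum.inl t) b = none := by
    rintro t ⟨b, hb⟩
    simp [Φ] at hb
  let ω : ∀ θ, (∃ b, Φ θ b = none) → Wt := fun θ => match θ with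
    | Sum.inl t => fun hb => (hnone t hb).elim
    | Sum.inr t => fun _ => t.1
  refine cyc_gdd hn Φ ω ?_ ?_ ?_
  · rintro (t | t) a b ha hb
    · exact (hnone t ⟨a, ha⟩).elim
    · have h0 : ∀ a, Φ (Sum.inr t) a = none → a = 0 := by
        intro a
        refine Fin.cases ?_ ?_ a
        · simp
        · intro i hi
          simp [Φ] at hi
      rw [h0 a ha, h0 b hb]
  · intro w i
    obtain ⟨⟨c, a⟩, hc, hu⟩ := hpart w i
    refine ⟨(Sum.inr (w, c), a.succ), ⟨⟨⟨0, by simp [Φ]⟩, rfl⟩, by simpa [Φ] using hc⟩, ?_⟩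
    rintro ⟨(t | ⟨w', c'⟩), b⟩ ⟨⟨hb, hw⟩, hi⟩
    · exact (hnone t hb).elim
    · have hw : w' = w := hw
      subst hw
      revert hi
      refine Fin.cases ?_ ?_ b
      · simp [Φ]
      · intro b hi
        have := hu (c', b) (by simpa [Φ] using hi)
        simp only [Prod.mk.injEq] at this
        rw [this.1, this.2]
  · intro i j
    rw [Nat.card_eq_fintype_card, Fintype.card_subtype, Finset.card_filter, Fintype.sum_prod_type,
      Fintype.sum_sum_type, Fintype.sum_sigma, Fintype.sum_prod_type, ← h i j]
    congr 1
    · apply Finset.sum_congr rfl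
      intro φ _
      simp [Φ, pcount]
    · have : ∀ (w : Wt) (c : J), (∑ x : Fin (K+1) × Fin (K+1),
          if x.1 ≠ x.2 ∧ Φ (Sum.inr (w, c)) x.1 = some i ∧ Φ (Sum.inr (w, c)) x.2 = some j
          then 1 else 0) = pcount (part c) i j := by
        intro w c
        rw [pcount, Fintype.sum_prod_type, Fintype.sum_prod_type, Fin.sum_univ_succ]
        simp only [Fin.sum_univ_succ]
        simp [Φ]
      simp only [this]
      simp [padj]

/-- Groups of size `g` with a suitable prime number of groups. -/
theorem gdd_start (K : ℕ) (hK : 1 ≤ K) (g : ℕ) (hg : 0 < g) (W : ℕ) (hW : 0 < W) :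
    ∃ p : ℕ, p.Prime ∧ W ∣ p - 1 ∧ DD (K+1) p g 0 := by
  have : Nonempty (Fin g) := ⟨⟨0, hg⟩⟩
  obtain ⟨β, hβ, hs⟩ := pcount_total (K+1) (by omega) (Fin g)
  have hn : 0 < W * β := by positivity
  obtain ⟨N, hN⟩ := gdd_of_mu hn (J := Empty) (Wt := Empty) (K := K) (I := Fin g)
    (fun c => c.elim) (fun w => w.elim) (fun _ => 2 * W) (by
      intro x y
      rw [← Finset.mul_sum, hs]
      simp; ring)
  have hcop : (1 + 2 * (W * β)).Coprime (2 * (2 * (W * β))) := by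
    apply Nat.Coprime.mul_right
    · simp
    · simp
  obtain ⟨p, hpN, hp, hmod⟩ := Nat.forall_exists_prime_gt_and_modEq (N + 1 + 2 * (W * β))
    (q := 2 * (2 * (W * β))) (by positivity) hcop
  have h1 : 2 * (2 * (W * β)) ∣ p - (1 + 2 * (W * β)) := (Nat.modEq_iff_dvd' (by omega)).1 hmod.symm
  obtain ⟨d, hd⟩ := h1
  have hp' : p = 1 + 2 * (W * β) * (2 * d + 1) := by
    have : p = 1 + 2 * (W * β) + 2 * (2 * (W * β)) * d := by omega
    rw [this]; ring
  have := hN p (2 * d + 1) hp (by omega) ⟨d, rfl⟩ hp'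
  refine ⟨p, hp, ?_, by simpa using this⟩
  rw [hp', Nat.add_sub_cancel_left]
  exact ⟨2 * β * (2 * d + 1), by ring⟩

theorem gdd_key (K : ℕ) (hK : 1 ≤ K) (M : ℕ) (hM : 0 < M) (hdvd : (K+1) * K ∣ M) (J W0 : ℕ)
    (hW : 0 < W0) (N0 : ℕ) : ∃ p h : ℕ, N0 < p ∧ p.Prime ∧ p ≡ 1 [MOD W0] ∧ 0 < h ∧
      h ≡ 1 [MOD W0] ∧ ∀ j ≤ J, DD (K+1) p M (K * j * h) := by
  obtain ⟨d, rfl⟩ := hdvd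
  have hd : 0 < d := by
    rcases Nat.eq_zero_or_pos d with h | h
    · simp [h] at hM
    · exact h
  set T := (K+1) * d with hT
  have hM' : (K+1) * K * d = T * K := by rw [hT]; ring
  rw [hM'] at hM ⊢
  have : Nonempty (Fin (T * K)) := ⟨⟨0, hM⟩⟩
  obtain ⟨β, hβ, hs⟩ := pcount_total (K+1) (by omega) (Fin (T * K))
  let part : Fin T → Fin K → Fin (T * K) := fun c a => finProdFinEquiv (c, a)
  obtain ⟨ν, hν⟩ := pvec_span part (by
    intro c a a' h
    have := finProdFinEquiv.injective h
    simpa using this) (by simp [hT])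
  obtain ⟨b0, hb0⟩ : ∃ b0 : ℕ, ∀ φ, |ν φ| ≤ b0 := by
    refine ⟨∑ φ, (ν φ).natAbs, fun φ => ?_⟩
    rw [Int.abs_eq_natAbs]
    exact_mod_cast Finset.single_le_sum (f := fun φ => (ν φ).natAbs) (fun _ _ => Nat.zero_le _)
      (Finset.mem_univ φ)
  set n := W0 * (J * b0 + 1) * β with hn
  have hnpos : 0 < n := by positivity
  have main : ∀ j : Fin (J+1), ∃ N : ℕ, ∀ p h : ℕ, p.Prime → N ≤ p → Odd h → p = 1 + 2 * n * h →
      DD (K+1) p (T * K) (K * j * h) := by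
    intro j
    have hpos : ∀ φ, 0 ≤ (j : ℤ) * ν φ + (2 * W0 * (J * b0 + 1) : ℕ) := by
      intro φ
      have h1 := (abs_le.1 (hb0 φ)).1
      have h2 : (j : ℤ) ≤ J := by exact_mod_cast Nat.lt_succ_iff.1 j.2
      have h3 : (0:ℤ) ≤ j := by positivity
      have h4 : (j : ℤ) * b0 ≤ J * b0 := by gcongr
      have h5 : (j : ℤ) * ν φ ≥ - (j * b0) := by nlinarith
      have h6 : (1 : ℤ) ≤ W0 := by exact_mod_cast hW
      push_cast
      have h7 : (0:ℤ) ≤ J * b0 := by positivity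
      nlinarith
    have := gdd_of_mu hnpos (Wt := Fin (K * j)) part (by
      intro _ i
      refine ⟨finProdFinEquiv.symm i, ?_, ?_⟩
      · exact finProdFinEquiv.apply_symm_apply i
      · rintro ⟨c, a⟩ rfl
        simp [part]) (fun φ => ((j : ℤ) * ν φ + (2 * W0 * (J * b0 + 1) : ℕ)).toNat) (by
      intro x y
      have hz : ((∑ φ, ((j : ℤ) * ν φ + (2 * W0 * (J * b0 + 1) : ℕ)).toNat * pcount φ x y +
          Fintype.card (Fin (K * j)) * padj part x y : ℕ) : ℤ) = (2 * n : ℕ) := by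
        push_cast [Int.toNat_of_nonneg (hpos _)]
        have e : ∀ φ : Fin (K+1) → Fin (T * K), ((j : ℤ) * ν φ + 2 * W0 * (J * b0 + 1)) * pcount φ x y =
            j * (ν φ * pcount φ x y) + (2 * W0 * (J * b0 + 1)) * pcount φ x y := by
          intro φ; ring
        have e' := fun φ => Int.toNat_of_nonneg (hpos φ)
        push_cast at e'
        have hs' : (∑ φ : Fin (K+1) → Fin (T*K), (pcount φ x y : ℤ)) = β := by
          exact_mod_cast hs x y
        rw [Finset.sum_congr rfl (fun φ _ => by rw [e' φ, e φ]), Finset.sum_add_distrib,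
          ← Finset.mul_sum, ← Finset.mul_sum, hν, hs', hn]
        simp only [Fintype.card_fin]
        push_cast
        ring
      exact_mod_cast hz)
    simpa using this
  choose N hN using main
  have hcop : (1 + 2 * n).Coprime (2 * (2 * n) * W0) := by
    have : W0 ∣ 2 * n := ⟨2 * ((J * b0 + 1) * β), by rw [hn]; ring⟩
    apply Nat.Coprime.mul_right
    · apply Nat.Coprime.mul_right <;> simp
    · exact Nat.Coprime.of_dvd_right this (by simp)
  obtain ⟨p, hpN, hp, hmod⟩ := Nat.forall_exists_prime_gt_and_modEq (N0 + ∑ j, N j + 1 + 2 * n)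
    (q := 2 * (2 * n) * W0) (by positivity) hcop
  have h1 := (Nat.modEq_iff_dvd' (by omega)).1 hmod.symm
  obtain ⟨t, ht⟩ := h1
  have hp' : p = 1 + 2 * n * (1 + W0 * (2 * t)) := by
    have : p = 1 + 2 * n + 2 * (2 * n) * W0 * t := by omega
    rw [this]; ring
  refine ⟨p, 1 + W0 * (2 * t), by omega, hp, ?_, by omega, ?_, ?_⟩
  · rw [hp', hn]
    have : 1 + 2 * (W0 * (J * b0 + 1) * β) * (1 + W0 * (2 * t)) =
      1 + W0 * (2 * (J * b0 + 1) * β * (1 + W0 * (2 * t))) := by ring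
    rw [this]
    simp [Nat.ModEq]
  · simp [Nat.ModEq]
  · intro j hj
    refine hN ⟨j, by omega⟩ p _ hp ?_ ⟨W0 * t, by ring⟩ hp'
    have := Finset.single_le_sum (f := N) (fun _ _ => Nat.zero_le _)
      (Finset.mem_univ ⟨j, by omega⟩)
    omega

theorem DD.fill {k a u g t e : ℕ} (h1 : DD k a (u * g) t) (h2 : DD k u g e) :
    DD k (a * u) g (t + e) := by
  have h1' := DD.toTypes h1 (Fin a) (Fin u × Fin g) (Fin t) (by simp) (by simp) (by simp)
  have h3 := Dec.fill h1' h2 (Dec.bot k (Fin t ⊕ Fin e))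
  exact DD.ofTypes h3 (by simp) (by simp) (by simp)

theorem DD.wtd {k q Q M W t : ℕ} (hQ0 : 0 < Q) (hQ : ∀ d : ℕ, 0 < d → d < q → Nat.Coprime d Q)
    (h0 : DD k q M 0) (h1 : DD k q M W) (ht : t ≤ Q) : DD k q (Q * M) (t * W) := by
  have : NeZero Q := ⟨hQ0.ne'⟩
  have h0' := DD.toTypes h0 (Fin q) (Fin M) Empty (by simp) (by simp) (by simp)
  have h3 := Dec.wtd (T := Fin t) (fun i => ((i : ℕ) : ZMod Q)) (by
    intro i j hij
    have := (ZMod.natCast_eq_natCast_iff _ _ _).1 hij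
    have := Nat.ModEq.eq_of_lt_of_lt this (by omega) (by omega)
    exact Fin.ext this) hQ h0' h1
  exact DD.ofTypes h3 (by simp) (by simp [ZMod.card]) (by simp)

theorem DD.drop {k U g : ℕ} (h : DD k (U + 1) g 0) : DD k U g g := by
  have h' := DD.toTypes h (Option (Fin U)) (Fin g) Empty (by simp) (by simp) (by simp)
  let f : (Option (Fin U) × Fin g) ⊕ Empty ≃ (Fin U × Fin g) ⊕ Fin g :=
    { toFun := fun x => match x with
        | Sum.inl (some a, x) => Sum.inl (a, x)
        | Sum.inl (none, x) => Sum.inr x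
        | Sum.inr z => z.elim
      invFun := fun x => match x with
        | Sum.inl (a, x) => Sum.inl (some a, x)
        | Sum.inr x => Sum.inl (none, x)
      left_inv := by
        rintro (⟨_ | a, x⟩ | z)
        · rfl
        · rfl
        · exact z.elim
      right_inv := by rintro (⟨a, x⟩ | z) <;> rfl }
  refine h'.equiv f ?_
  rintro (⟨_ | a, x⟩ | z) (⟨_ | b, y⟩ | z') <;> first | exact z.elim | exact z'.elim | skip
  all_goals simp [f, GR]

theorem DD.mul {k r Q U g e : ℕ} (hQ0 : 0 < Q)
    (hQ : ∀ d : ℕ, 0 < d → d < r → Nat.Coprime d Q) (h : DD k (Q * U) g e)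
    (h0 : DD k r (U * g) 0) : DD k (r * Q * U) g e := by
  have h1 := DD.wtd (t := 0) hQ0 hQ h0 h0 (Nat.zero_le _)
  rw [← mul_assoc, mul_zero] at h1
  have := DD.fill h1 h
  rwa [zero_add, ← mul_assoc] at this

/-- There are packings on `n` points with few uncovered pairs. -/
def Good (k g C n : ℕ) : Prop :=
  ∃ (X : Type) (_ : Fintype X) (R : X → X → Prop), Fintype.card X = n ∧ (∀ x, ¬ R x x) ∧
    Dec k R ∧ Nat.card {s : X × X // ¬ R s.1 s.2} ≤ g * n + C

theorem Good.step {k g C a u t e : ℕ} (h1 : DD k a (u * g) t) (h2 : DD k u g e)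
    (h : Good k g C (t + e)) : Good k g C (a * u * g + (t + e)) := by
  classical
  obtain ⟨X, _, R, hX, hirr, hD, hc⟩ := h
  have h1' := DD.toTypes h1 (Fin a) (Fin u × Fin g) (Fin t) (by simp) (by simp) (by simp)
  have σ : X ≃ Fin t ⊕ Fin e := Fintype.equivOfCardEq (by simp [hX])
  have hD' : Dec k (fun x y => R (σ.symm x) (σ.symm y)) := hD.equiv σ (by simp)
  have h3 := Dec.fill h1' h2 hD'
  refine ⟨_, inferInstance, _, ?_, ?_, h3, ?_⟩
  · simp
  · rintro (x | x)
    · simp [GR]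
    · simpa [GR] using hirr _
  · have inj : Nat.card {s : ((((Fin a × Fin u) × Fin g) ⊕ (Fin t ⊕ Fin e)) ×
        (((Fin a × Fin u) × Fin g) ⊕ (Fin t ⊕ Fin e))) //
        ¬ GR (Fin a × Fin u) (Fin g) (fun x y => R (σ.symm x) (σ.symm y)) s.1 s.2} ≤
        Nat.card (((Fin a × Fin u) × Fin g × Fin g) ⊕ {s : X × X // ¬ R s.1 s.2}) := by
      let F : (((Fin a × Fin u) × Fin g × Fin g) ⊕ {s : X × X // ¬ R s.1 s.2}) →
        {s : ((((Fin a × Fin u) × Fin g) ⊕ (Fin t ⊕ Fin e)) ×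
        (((Fin a × Fin u) × Fin g) ⊕ (Fin t ⊕ Fin e))) //
        ¬ GR (Fin a × Fin u) (Fin g) (fun x y => R (σ.symm x) (σ.symm y)) s.1 s.2} :=
        Sum.elim (fun z => ⟨(Sum.inl (z.1, z.2.1), Sum.inl (z.1, z.2.2)), by simp [GR]⟩)
          (fun s => ⟨(Sum.inr (σ s.1.1), Sum.inr (σ s.1.2)), by simpa [GR] using s.2⟩)
      apply Nat.card_le_card_of_surjective F
      rintro ⟨⟨(⟨x, i⟩ | x), (⟨y, j⟩ | y)⟩, h⟩
      · have : x = y := by simpa [GR] using h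
        subst this
        exact ⟨Sum.inl (x, i, j), rfl⟩
      · exact (h (by simp [GR])).elim
      · exact (h (by simp [GR])).elim
      · refine ⟨Sum.inr ⟨(σ.symm x, σ.symm y), by simpa [GR] using h⟩, ?_⟩
        simp [F]
    refine inj.trans ?_
    rw [Nat.card_sum]
    have : Nat.card ((Fin a × Fin u) × Fin g × Fin g) = a * u * (g * g) := by simp
    rw [this]
    nlinarith

theorem coprime_of_lt_prime {d r : ℕ} (h0 : 0 < d) (h : d < r) (hr : r.Prime) : Nat.Coprime d r :=
  (Nat.coprime_of_lt_prime h0.ne' h hr).symm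

theorem rec_data (K : ℕ) (hK : 1 ≤ K) (g : ℕ) (hg : 0 < g) :
    ∃ L W r1 r2 h : ℕ, 0 < L ∧ 0 < W ∧ K ∣ L ∧ K ∣ W ∧ r1.Prime ∧ r2.Prime ∧ r1 ≠ r2 ∧
      r1 ≡ 1 [MOD W] ∧ r2 ≡ 1 [MOD W] ∧ h ≡ 1 [MOD W] ∧
      ∀ C a b t j, t ≤ r1 ^ a * r2 ^ (b + 1) → j ≤ W → Good (K+1) g C (t * W + (K * j * h + g)) →
        Good (K+1) g C (L * (r1 ^ a * r2 ^ (b+1)) + (t * W + (K * j * h + g))) := by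
  obtain ⟨p0, hp0, hdvd, hstart⟩ := gdd_start K hK g hg ((K+1) * K) (by positivity)
  obtain ⟨U, rfl⟩ : ∃ U, p0 = U + 1 := ⟨p0 - 1, by have := hp0.pos; omega⟩
  rw [Nat.add_sub_cancel] at hdvd
  have hU : 0 < U := by have := hp0.two_le; omega
  have hUg := DD.drop hstart
  have hM : 0 < U * g := by positivity
  have hMd : (K+1) * K ∣ U * g := Dvd.dvd.mul_right hdvd g
  obtain ⟨q, hq, hqpos, hqp, -, hhq, -, hDq⟩ := gdd_key K hK (U * g) hM hMd 1 1 one_pos 0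
  have hq0 := hDq 0 (by omega)
  have hq1 := hDq 1 (by omega)
  rw [mul_zero, zero_mul] at hq0
  rw [mul_one] at hq1
  set W := K * hq with hWdef
  have hW : 0 < W := by positivity
  obtain ⟨r1, h1, hr1q, hr1p, hr1W, -, -, hD1⟩ := gdd_key K hK (U * g) hM hMd 0 W hW q
  obtain ⟨r2, h2, hr2q, hr2p, hr2W, -, hh2, hD2⟩ := gdd_key K hK (U * g) hM hMd W W hW r1
  have hD10 := hD1 0 le_rfl
  have hD20 := hD2 0 (Nat.zero_le _)
  rw [mul_zero, zero_mul] at hD10 hD20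
  refine ⟨q * (U * g), W, r1, r2, h2, by positivity, hW, ?_, Dvd.intro _ rfl, hr1p, hr2p,
    hr2q.ne, hr1W, hr2W, hh2, ?_⟩
  · exact Dvd.dvd.mul_left ((Dvd.intro_left _ rfl).trans hMd) _
  intro C a b t j ht hj hgood
  have c2 : ∀ b, DD (K+1) (r2 ^ (b+1) * U) g (K * j * h2 + g) := by
    intro b
    induction b with
    | zero =>
      rw [zero_add, pow_one]
      exact DD.fill (hD2 j hj) hUg
    | succ b ih =>
      have := DD.mul (r := r2) (pow_pos hr2p.pos _) (fun d hd hd' =>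
        Nat.Coprime.pow_right _ (coprime_of_lt_prime hd hd' hr2p)) ih hD20
      rwa [← pow_succ'] at this
  have c1 : ∀ a, DD (K+1) (r1 ^ a * r2 ^ (b+1) * U) g (K * j * h2 + g) := by
    intro a
    induction a with
    | zero =>
      rw [pow_zero, one_mul]
      exact c2 b
    | succ a ih =>
      have := DD.mul (r := r1) (mul_pos (pow_pos hr1p.pos _) (pow_pos hr2p.pos _)) (fun d hd hd' =>
        Nat.Coprime.mul_right (Nat.Coprime.pow_right _ (coprime_of_lt_prime hd hd' hr1p))
        (Nat.Coprime.pow_right _ (coprime_of_lt_prime hd (hd'.trans hr2q) hr2p))) ih hD10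
      rwa [← mul_assoc, ← pow_succ'] at this
  set Q := r1 ^ a * r2 ^ (b+1) with hQ
  have hQ0 : 0 < Q := mul_pos (pow_pos hr1p.pos _) (pow_pos hr2p.pos _)
  have hw := DD.wtd (t := t) hQ0 (fun d hd hd' =>
        Nat.Coprime.mul_right (Nat.Coprime.pow_right _ (coprime_of_lt_prime hd (hd'.trans hr1q) hr1p))
        (Nat.Coprime.pow_right _ (coprime_of_lt_prime hd ((hd'.trans hr1q).trans hr2q) hr2p)))
        hq0 hq1 ht
  rw [← mul_assoc] at hw
  have := Good.step hw (c1 a) hgood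
  convert this using 1
  ring

theorem dens_aux {α β δ : ℝ} (hβ : 0 < β) (a1 b1 a2 b2 : ℕ)
    (hlt : (a1 * α + b1 * β : ℝ) < a2 * α + b2 * β)
    (hd : (a2 * α + b2 * β : ℝ) ≤ a1 * α + b1 * β + δ) :
    ∃ Y0 : ℝ, ∀ Y ≥ Y0, ∃ a b : ℕ, (a * α + b * β : ℝ) ≤ Y ∧ Y < a * α + b * β + δ := by
  set lo : ℝ := a1 * α + b1 * β with hlo
  set hi : ℝ := a2 * α + b2 * β with hhi
  have hD : 0 < hi - lo := by linarith
  obtain ⟨c, hc⟩ := exists_nat_gt (β / (hi - lo))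
  refine ⟨c * lo, fun Y hY => ?_⟩
  set b' := ⌊(Y - c * lo) / β⌋₊ with hb'
  have e1 : (b' : ℝ) ≤ (Y - c * lo) / β := Nat.floor_le (div_nonneg (by linarith) hβ.le)
  have e2 : (Y - c * lo) / β < b' + 1 := Nat.lt_floor_add_one _
  rw [le_div_iff₀ hβ] at e1
  rw [div_lt_iff₀ hβ] at e2
  set ρ := Y - c * lo - b' * β with hρ
  have hρ0 : 0 ≤ ρ := by rw [hρ]; linarith
  have hρ1 : ρ < β := by rw [hρ]; linarith
  set i := ⌊ρ / (hi - lo)⌋₊ with hi'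
  have e3 : (i : ℝ) ≤ ρ / (hi - lo) := Nat.floor_le (div_nonneg hρ0 hD.le)
  have e4 : ρ / (hi - lo) < i + 1 := Nat.lt_floor_add_one _
  have hic : i ≤ c := by
    have : (i : ℝ) ≤ c := e3.trans ((div_le_div_of_nonneg_right hρ1.le hD.le).trans hc.le)
    exact_mod_cast this
  rw [le_div_iff₀ hD] at e3
  rw [div_lt_iff₀ hD] at e4
  obtain ⟨f, hf⟩ := Nat.exists_eq_add_of_le hic
  have hf' : (c : ℝ) = i + f := by exact_mod_cast hf
  have key : (((f * a1 + i * a2 : ℕ) : ℝ) * α + ((b' + f * b1 + i * b2 : ℕ) : ℝ) * β) =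
      b' * β + f * lo + i * hi := by
    rw [hlo, hhi]; push_cast; ring
  refine ⟨f * a1 + i * a2, b' + f * b1 + i * b2, ?_, ?_⟩
  · rw [key]
    rw [hf'] at hρ
    nlinarith
  · rw [key]
    rw [hf'] at hρ
    nlinarith

theorem dens_log {r1 r2 : ℕ} (h1 : r1.Prime) (h2 : r2.Prime) (hne : r1 ≠ r2) {δ : ℝ} (hδ : 0 < δ) :
    ∃ Y0 : ℝ, ∀ Y ≥ Y0, ∃ a b : ℕ, (a * Real.log r1 + b * Real.log r2 : ℝ) ≤ Y ∧
      Y < a * Real.log r1 + b * Real.log r2 + δ := by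
  have hα : 0 < Real.log r1 := Real.log_pos (by exact_mod_cast h1.one_lt)
  have hβ : 0 < Real.log r2 := Real.log_pos (by exact_mod_cast h2.one_lt)
  obtain ⟨N, hN⟩ := exists_nat_gt (Real.log r2 / δ)
  obtain ⟨j, k, hk, -, hjk⟩ := Real.exists_int_int_abs_mul_sub_le (Real.log r1 / Real.log r2)
    (n := N + 1) (Nat.succ_pos _)
  have hk' : (0:ℝ) < k := by exact_mod_cast hk
  have hlt1 : (1 : ℝ) / ((N + 1 : ℕ) + 1) < 1 := by
    rw [div_lt_one (by positivity)]
    push_cast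
    have : (0:ℝ) ≤ N := by positivity
    linarith
  have hj : 0 ≤ j := by
    have h3 := (abs_le.1 hjk).2
    have h4 : 0 < (k:ℝ) * (Real.log r1 / Real.log r2) := by positivity
    have : (-1 : ℝ) < j := by linarith
    have : -1 < j := by exact_mod_cast this
    omega
  obtain ⟨k, rfl⟩ := Int.eq_ofNat_of_zero_le hk.le
  obtain ⟨j, rfl⟩ := Int.eq_ofNat_of_zero_le hj
  push_cast at hjk
  have hclose : |(k : ℝ) * Real.log r1 - j * Real.log r2| ≤ δ := by
    have e : (k : ℝ) * Real.log r1 - j * Real.log r2 =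
      (k * (Real.log r1 / Real.log r2) - j) * Real.log r2 := by
      field_simp
    rw [e, abs_mul, abs_of_pos hβ]
    calc _ ≤ 1 / ((N:ℝ) + 1 + 1) * Real.log r2 := by gcongr
      _ ≤ δ := by
        rw [div_lt_iff₀ hδ] at hN
        rw [one_div, inv_mul_le_iff₀ (by positivity)]
        nlinarith
  have hneq : (k : ℝ) * Real.log r1 ≠ j * Real.log r2 := by
    intro h
    rw [← Real.log_pow, ← Real.log_pow] at h
    have h1p : (0:ℝ) < (r1:ℝ) ^ k := pow_pos (by exact_mod_cast h1.pos) _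
    have h2p : (0:ℝ) < (r2:ℝ) ^ j := pow_pos (by exact_mod_cast h2.pos) _
    have h := Real.log_injOn_pos h1p h2p h
    have h : r1 ^ k = r2 ^ j := by exact_mod_cast h
    have hk0 : k ≠ 0 := by rintro rfl; simp at hk
    have : r1 ∣ r2 ^ j := h ▸ dvd_pow_self r1 hk0
    exact hne ((Nat.prime_dvd_prime_iff_eq h1 h2).1 (h1.dvd_of_dvd_pow this))
  rw [abs_le] at hclose
  rcases lt_or_gt_of_ne hneq with h | h
  · exact dens_aux hβ k 0 0 j (by simpa using h) (by simp; linarith [hclose.1])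
  · exact dens_aux hβ 0 j k 0 (by simpa using h) (by simp; linarith [hclose.2])

theorem dens {r1 r2 : ℕ} (h1 : r1.Prime) (h2 : r2.Prime) (hne : r1 ≠ r2) {L W : ℕ} (hL : 0 < L)
    (hW : 0 < W) : ∃ Y0 : ℕ, ∀ y ≥ Y0, ∃ a b : ℕ, L * (r1 ^ a * r2 ^ (b+1)) ≤ y ∧
      y ≤ (L + W) * (r1 ^ a * r2 ^ (b+1)) := by
  have hLr : (0:ℝ) < L := by exact_mod_cast hL
  have hWr : (0:ℝ) < W := by exact_mod_cast hW
  have h1r : (0:ℝ) < r1 := by exact_mod_cast h1.pos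
  have h2r : (0:ℝ) < r2 := by exact_mod_cast h2.pos
  have hδ : 0 < Real.log (1 + W / L) := Real.log_pos (by
    have : (0:ℝ) < W / L := by positivity
    linarith)
  obtain ⟨Y0, hY0⟩ := dens_log h1 h2 hne hδ
  obtain ⟨y0, hy0⟩ := exists_nat_gt (Real.exp (Y0 + Real.log r2) * L)
  refine ⟨y0 + 1, fun y hy => ?_⟩
  have hyr : (0:ℝ) < y := by exact_mod_cast (by omega : 0 < y)
  have hyy : (y0:ℝ) ≤ y := by exact_mod_cast (by omega : y0 ≤ y)
  obtain ⟨a, b, e1, e2⟩ := hY0 (Real.log (y / L) - Real.log r2) (by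
    have : Y0 + Real.log r2 ≤ Real.log (y / L) := by
      rw [Real.le_log_iff_exp_le (by positivity), le_div_iff₀ hLr]
      linarith
    linarith)
  have hval : (a * Real.log r1 + b * Real.log r2 + Real.log r2 : ℝ) =
      Real.log ((r1:ℝ) ^ a * (r2:ℝ) ^ (b+1)) := by
    rw [Real.log_mul (by positivity) (by positivity), Real.log_pow, Real.log_pow]
    push_cast; ring
  have e1' : Real.log ((r1:ℝ) ^ a * (r2:ℝ) ^ (b+1)) ≤ Real.log (y / L) := by linarith
  have e2' : Real.log (y / L) < Real.log ((r1:ℝ) ^ a * (r2:ℝ) ^ (b+1) * (1 + W / L)) := by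
    rw [Real.log_mul (by positivity) (by positivity)]
    linarith
  rw [Real.log_le_log_iff (by positivity) (by positivity), le_div_iff₀ hLr] at e1'
  rw [Real.log_lt_log_iff (by positivity) (by positivity), div_lt_iff₀ hLr] at e2'
  refine ⟨a, b, ?_, ?_⟩
  · have : ((L * (r1 ^ a * r2 ^ (b+1)) : ℕ) : ℝ) ≤ y := by push_cast; linarith
    exact_mod_cast this
  · have : (y : ℝ) ≤ (((L + W) * (r1 ^ a * r2 ^ (b+1)) : ℕ) : ℝ) := by
      push_cast
      have : (r1:ℝ) ^ a * (r2:ℝ) ^ (b+1) * (1 + W / L) * L = (L + W) * (r1 ^ a * r2 ^ (b+1)) := by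
        field_simp
      linarith
    exact_mod_cast this

theorem good_all (K : ℕ) (hK : 1 ≤ K) (g : ℕ) (hg : 0 < g) :
    ∃ C : ℕ, ∀ n, n ≡ g [MOD K] → Good (K+1) g C n := by
  obtain ⟨L, W, r1, r2, h, hL, hW, hKL, hKW, hr1, hr2, hne, hm1, hm2, hmh, hstep⟩ :=
    rec_data K hK g hg
  obtain ⟨Y0, hY0⟩ := dens hr1 hr2 hne hL hW
  set n0 := Y0 + (K * W * h + g) + L with hn0
  refine ⟨n0 * n0, ?_⟩
  intro n
  induction n using Nat.strong_induction_on with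
  | _ n ih =>
    intro hn
    rcases lt_or_ge n n0 with hlt | hge
    · refine ⟨Fin n, inferInstance, fun _ _ => False, by simp, by simp, Dec.bot _ _, ?_⟩
      have : Nat.card {s : Fin n × Fin n // ¬ False} = n * n := by simp
      rw [this]
      have := Nat.mul_le_mul hlt.le hlt.le
      omega
    · have hge' : L + g ≤ n := by omega
      have hdvd : K ∣ n - (L + g) := by
        have h1 : K ∣ n - g := (Nat.modEq_iff_dvd' (by omega)).1 hn.symm
        have : n - (L + g) = (n - g) - L := by omega
        rw [this]
        exact Nat.dvd_sub h1 hKL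
      obtain ⟨x, hx⟩ := hdvd
      set j := x % W with hj
      have hjW : j < W := Nat.mod_lt _ hW
      have hjx : j ≡ x [MOD W] := Nat.mod_modEq _ _
      have hle : K * j * h ≤ K * W * h := by gcongr
      obtain ⟨a, b, hy1, hy2⟩ := hY0 (n - (K * j * h + g)) (by omega)
      set Q := r1 ^ a * r2 ^ (b+1) with hQ
      have hQ0 : 0 < Q := mul_pos (pow_pos hr1.pos _) (pow_pos hr2.pos _)
      have hQ1 : Q ≡ 1 [MOD W] := by
        have := (hm1.pow a).mul (hm2.pow (b+1))
        simpa using this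
      have hmod : L * Q + (K * j * h + g) ≡ n [MOD W] := by
        have e1 : L * Q + (K * j * h + g) ≡ L * 1 + (K * x * 1 + g) [MOD W] :=
          (hQ1.mul_left L).add ((((hjx.mul_left K)).mul hmh).add_right g)
        have e2 : L * 1 + (K * x * 1 + g) = n := by omega
        rwa [e2] at e1
      have hLQ : L * Q + (K * j * h + g) ≤ n := by omega
      obtain ⟨t, ht⟩ := (Nat.modEq_iff_dvd' hLQ).1 hmod
      have hn' : n = L * Q + (t * W + (K * j * h + g)) := by
        rw [mul_comm t W]; omega
      have htQ : t ≤ Q := by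
        have h1 : t * W ≤ Q * W := by
          have : (L + W) * Q = L * Q + Q * W := by ring
          omega
        exact Nat.le_of_mul_le_mul_right h1 hW
      have hLQ0 : 0 < L * Q := by positivity
      have hmod' : t * W + (K * j * h + g) ≡ g [MOD K] := by
        have e1 : K ∣ t * W + K * j * h :=
          Dvd.dvd.add (Dvd.dvd.mul_left hKW t) ⟨j * h, by ring⟩
        rw [← add_assoc]
        have := (Nat.modEq_zero_iff_dvd.2 e1).add_right g
        simpa using this
      have := hstep _ a b t j htQ hjW.le (ih _ (by omega) hmod')
      rw [← hQ, ← hn'] at this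
      exact this

theorem Good.count {K g C n : ℕ} (h : Good (K+1) g C n) :
    ∃ B : Finset (Finset (Fin n)), (∀ b ∈ B, b.card = K + 1) ∧
      (∀ b ∈ B, ∀ b' ∈ B, ∀ x y, x ≠ y → x ∈ b → y ∈ b → x ∈ b' → y ∈ b' → b = b') ∧
      n * n ≤ B.card * ((K+1) * K) + (g * n + C) := by
  classical
  obtain ⟨X, _, R, hX, hirr, hD, hc⟩ := h
  have σ : X ≃ Fin n := Fintype.equivFinOfCardEq hX
  have hD' : Dec (K+1) (fun x y => R (σ.symm x) (σ.symm y)) := hD.equiv σ (by simp)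
  obtain ⟨B, h1, h2, h3, h4⟩ := hD'
  refine ⟨B.toFinite.toFinset, by simpa using h1, by simpa using h4, ?_⟩
  set B' := B.toFinite.toFinset with hB'
  have hsub : (Finset.univ : Finset (Fin n × Fin n)) ⊆ (B'.biUnion fun b => b.offDiag) ∪
      (Finset.univ.filter fun s : Fin n × Fin n => ¬ R (σ.symm s.1) (σ.symm s.2)) := by
    rintro ⟨x, y⟩ _
    by_cases hR : R (σ.symm x) (σ.symm y)
    · obtain ⟨b, hb, hx, hy⟩ := h3 x y hR
      have hxy : x ≠ y := by
        rintro rfl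
        exact hirr _ hR
      apply Finset.mem_union_left
      simp only [Finset.mem_biUnion, Finset.mem_offDiag]
      exact ⟨b, by simpa [hB'] using hb, hx, hy, hxy⟩
    · apply Finset.mem_union_right
      simpa using hR
  have hcard := (Finset.card_le_card hsub).trans (Finset.card_union_le _ _)
  have hb1 : (B'.biUnion fun b => b.offDiag).card ≤ B'.card * ((K+1) * K) := by
    apply Finset.card_biUnion_le_card_mul
    intro b hb
    rw [Finset.offDiag_card, h1 b (by simpa [hB'] using hb)]
    have : (K+1) * (K+1) = (K+1) * K + (K+1) := by ring
    omega
  have hb2 : (Finset.univ.filter fun s : Fin n × Fin n => ¬ R (σ.symm s.1) (σ.symm s.2)).card =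
      Nat.card {s : X × X // ¬ R s.1 s.2} := by
    rw [← Fintype.card_subtype, ← Nat.card_eq_fintype_card]
    apply Nat.card_congr
    exact Equiv.subtypeEquiv (Equiv.prodCongr σ.symm σ.symm) (by simp)
  rw [hb2] at hcard
  simp only [Finset.card_univ, Fintype.card_prod, Fintype.card_fin] at hcard
  omega


/-- Asymptotically good 2-(n,k,1) packings: for every `k ≥ 2` there is a constant `c`
such that for all `n` there is a 2-(n,k,1) packing with at least
`⌊(n/k)·⌊(n−1)/(k−1)⌋⌋ − c` blocks. -/
theorem exists_good_packing (k : ℕ) (hk : 2 ≤ k) :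
    ∃ c : ℕ, ∀ n : ℕ, 0 < n →
      ∃ B : Finset (Finset (Fin n)),
        (∀ K ∈ B, K.card = k) ∧
        (∀ T : Finset (Fin n), T.card = 2 →
          ∀ K ∈ B, ∀ K' ∈ B, T ⊆ K → T ⊆ K' → K = K') ∧
        ((n * ((n - 1) / (k - 1)) / k : ℕ) : ℤ) - (c : ℤ) ≤ (B.card : ℤ) := by
  obtain ⟨K, rfl⟩ : ∃ K, k = K + 1 := ⟨k - 1, by omega⟩
  have hK : 1 ≤ K := by omega
  have hall : ∀ s : Fin K, ∃ C : ℕ, ∀ n, n ≡ (s : ℕ) + 1 [MOD K] → Good (K+1) (s + 1) C n :=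
    fun s => good_all K hK (s + 1) (Nat.succ_pos _)
  choose C hC using hall
  refine ⟨∑ s, C s, fun n hn => ?_⟩
  have hs : (n - 1) % K < K := Nat.mod_lt _ (by omega)
  have hdiv := Nat.div_add_mod (n - 1) K
  set s : Fin K := ⟨(n - 1) % K, hs⟩ with hsdef
  set m := (n - 1) / K with hm
  have hnm : n = K * m + ((s : ℕ) + 1) := by
    simp only [hsdef]; omega
  have hmod : n ≡ (s : ℕ) + 1 [MOD K] := by
    rw [hnm]
    simp [Nat.ModEq]
  obtain ⟨B, h1, h2, h3⟩ := (hC s n hmod).count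
  refine ⟨B, h1, ?_, ?_⟩
  · intro T hT b hb b' hb' hTb hTb'
    obtain ⟨x, y, hxy, rfl⟩ := Finset.card_eq_two.1 hT
    exact h2 b hb b' hb' x y hxy (hTb (by simp)) (hTb (by simp)) (hTb' (by simp)) (hTb' (by simp))
  · have hCs : C s ≤ ∑ s, C s := Finset.single_le_sum (fun _ _ => Nat.zero_le _) (Finset.mem_univ s)
    have key : n * m ≤ (B.card + C s) * (K + 1) := by
      have e1 : n * n = n * m * K + ((s : ℕ) + 1) * n := by
        nth_rewrite 2 [hnm]
        ring
      have e2 : n * m * K ≤ B.card * ((K+1) * K) + C s := by omega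
      have e3 : n * m * K ≤ ((B.card + C s) * (K + 1)) * K := by
        have e4 : C s * 1 ≤ C s * ((K + 1) * K) := Nat.mul_le_mul_left _ (by nlinarith)
        have e5 : ((B.card + C s) * (K + 1)) * K = B.card * ((K+1) * K) + C s * ((K+1) * K) := by ring
        omega
      exact Nat.le_of_mul_le_mul_right e3 (by omega)
    have : n * ((n - 1) / (K + 1 - 1)) / (K + 1) ≤ B.card + C s := by
      rw [Nat.add_sub_cancel, ← hm]
      apply Nat.div_le_of_le_mul
      linarith
    have : n * ((n - 1) / (K + 1 - 1)) / (K + 1) ≤ B.card + ∑ s, C s := by omega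
    have : ((n * ((n - 1) / (K + 1 - 1)) / (K + 1) : ℕ) : ℤ) ≤ ((B.card + ∑ s, C s : ℕ) : ℤ) := by
      exact_mod_cast this
    push_cast at this ⊢
    linarith
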